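/- arXiv:2508.00666 — 3 statements merged into one kernel-verified Lean document; each statement's English description precedes it below -/
import Mathlib

section
/- Let Ω ⊆ ℂ∖(-∞,0] be a simply connected domain, convex in the positive direction and not contained in any horizontal half-plane, let h be a Koenigs map onto Ω, and suppose θ_Ω⁻ = Θ_Ω⁻, θ_Ω⁺ = Θ_Ω⁺ and θ_Ω = θ_Ω⁻ + θ_Ω⁺ ∈ (0,π). Then: (i) for every λ of the form λ = ρ e^{iφ} with ρ > 0 and φ ∈ (π/2 + θ_Ω⁻, 3π/2 - θ_Ω⁺) one has D(e^{λh}) < ∞; and (ii) if λ ≠ 0 and D(e^{λh}) < ∞, then λ = ρ e^{iφ} for some ρ > 0 and φ ∈ [π/2 + θ_Ω⁻, 3π/2 - θ_Ω⁺]. Equivalently, iS(θ_Ω⁻, π-θ_Ω⁺) ∪ {0} ⊆ σ_D ⊆ i·closure(S(θ_Ω⁻, π-θ_Ω⁺)). (Theorem 1.4(b).) -/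
open MeasureTheory Set Complex Metric
open scoped ENNReal NNReal

noncomputable section

/-- The Dirichlet integral `D(f) = ∫_𝔻 |f'(z)|² dA(z)` over the unit disk. -/
def dirichletIntegral (f : ℂ → ℂ) : ℝ≥0∞ :=
  ∫⁻ z in ball (0 : ℂ) 1, (‖deriv f z‖₊ : ℝ≥0∞) ^ 2

/-- `h` is a Koenigs map onto `Ω`: an injective holomorphic map on the unit disk with image `Ω`. -/
def IsKoenigsMap (h : ℂ → ℂ) (Ω : Set ℂ) : Prop :=
  DifferentiableOn ℂ h (ball 0 1) ∧ InjOn h (ball 0 1) ∧ h '' ball 0 1 = Ω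

/-- `Ω` is convex in the positive direction: `Ω + t ⊆ Ω` for all `t ≥ 0`. -/
def ConvexPosDir (Ω : Set ℂ) : Prop :=
  ∀ t : ℝ, 0 ≤ t → ∀ w ∈ Ω, w + (t : ℂ) ∈ Ω

/-- The open angular sector `S(α,β) = {w ≠ 0 : α < arg w < β}` (principal argument). -/
def sector (a b : ℝ) : Set ℂ :=
  {w : ℂ | w ≠ 0 ∧ a < Complex.arg w ∧ Complex.arg w < b}

/-- The lower inner argument `θ_Ω⁻`, for a domain in the slit plane. -/
def lowerInnerArg (Ω : Set ℂ) : ℝ :=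
  sSup ({0} ∪ {θ : ℝ | θ ∈ Ioc 0 Real.pi ∧
    ∃ q : ℂ, (fun w => q + w) '' sector (-θ) 0 ⊆ Ω ∩ sector (-Real.pi) 0})

/-- The lower outer argument `Θ_Ω⁻`, for a domain in the slit plane. -/
def lowerOuterArg (Ω : Set ℂ) : ℝ :=
  sInf {θ : ℝ | θ ∈ Ioc 0 Real.pi ∧
    ∃ q : ℂ, Ω ∩ sector (-Real.pi) 0 ⊆ (fun w => q + w) '' sector (-θ) 0}

/-- The upper inner argument `θ_Ω⁺`, for a domain in the slit plane. -/
def upperInnerArg (Ω : Set ℂ) : ℝ :=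
  sSup ({0} ∪ {θ : ℝ | θ ∈ Ioc 0 Real.pi ∧
    ∃ q : ℂ, (fun w => q + w) '' sector 0 θ ⊆ Ω ∩ sector 0 Real.pi})

/-- The upper outer argument `Θ_Ω⁺`, for a domain in the slit plane. -/
def upperOuterArg (Ω : Set ℂ) : ℝ :=
  sInf {θ : ℝ | θ ∈ Ioc 0 Real.pi ∧
    ∃ q : ℂ, Ω ∩ sector 0 Real.pi ⊆ (fun w => q + w) '' sector 0 θ}

lemma det_restrictScalars_toSpanSingleton (a : ℂ) :
    ((ContinuousLinearMap.toSpanSingleton ℂ a).restrictScalars ℝ).det = ‖a‖ ^ 2 := by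
  simp [ContinuousLinearMap.det, LinearMap.det_restrictScalars, Algebra.norm_complex_eq,
    Complex.normSq_eq_norm_sq]

/-- Area formula for the Dirichlet integral of `exp (lam * h)`. -/
lemma dirichletIntegral_exp_mul {h : ℂ → ℂ} {Ω : Set ℂ} (hK : IsKoenigsMap h Ω) (lam : ℂ) :
    dirichletIntegral (fun z => Complex.exp (lam * h z)) =
      ∫⁻ w in Ω, ENNReal.ofReal (‖lam * Complex.exp (lam * w)‖ ^ 2) := by
  obtain ⟨hd, hi, himg⟩ := hK
  have hder : ∀ z ∈ ball (0 : ℂ) 1, HasDerivAt h (deriv h z) z := fun z hz =>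
    (hd.differentiableAt (isOpen_ball.mem_nhds hz)).hasDerivAt
  rw [← himg, lintegral_image_eq_lintegral_abs_det_fderiv_mul volume measurableSet_ball
    (fun z hz => ((hder z hz).hasFDerivAt.restrictScalars ℝ).hasFDerivWithinAt) hi]
  refine setLIntegral_congr_fun measurableSet_ball fun z hz => ?_
  have h1 := ((hder z hz).const_mul lam).cexp.deriv
  simp only [det_restrictScalars_toSpanSingleton]
  rw [h1, ← ENNReal.ofReal_mul (abs_nonneg _), abs_of_nonneg (sq_nonneg _), ← mul_pow,
    ← norm_mul, ENNReal.ofReal_pow (norm_nonneg _), ofReal_norm]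
  congr 2
  ring_nf

lemma re_polar_mul (ρ φ : ℝ) (w : ℂ) :
    ((ρ : ℂ) * Complex.exp ((φ : ℂ) * Complex.I) * w).re =
      ρ * ‖w‖ * Real.cos (φ + Complex.arg w) := by
  conv_lhs => rw [← Complex.norm_mul_exp_arg_mul_I w]
  have : (ρ : ℂ) * Complex.exp ((φ : ℂ) * Complex.I) *
      (‖w‖ * Complex.exp (Complex.arg w * Complex.I)) =
      ((ρ * ‖w‖ : ℝ) : ℂ) * Complex.exp (((φ + Complex.arg w : ℝ) : ℂ) * Complex.I) := by
    push_cast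
    rw [add_mul, Complex.exp_add]
    ring
  rw [this, Complex.re_ofReal_mul, Complex.exp_ofReal_mul_I_re]

lemma norm_sq_mul_exp (lam w : ℂ) :
    ‖lam * Complex.exp (lam * w)‖ ^ 2 = ‖lam‖ ^ 2 * Real.exp (2 * (lam * w).re) := by
  rw [norm_mul, Complex.norm_exp, mul_pow, ← Real.exp_nat_mul]
  norm_num

lemma integrable_exp_neg_mul_norm {c : ℝ} (hc : 0 < c) :
    Integrable fun w : ℂ => Real.exp (-c * ‖w‖) := by
  have key := Complex.integral_exp_neg_mul_rpow le_rfl hc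
  simp only [Real.rpow_one] at key
  refine Integrable.of_integral_ne_zero ?_
  rw [key]
  have := Real.Gamma_pos_of_pos (show (0 : ℝ) < 2 / 1 + 1 by norm_num)
  positivity

lemma exists_forall_cos_le_neg {a b : ℝ} (ha : Real.pi / 2 < a) (hb : b < 3 * Real.pi / 2) :
    ∃ c > 0, ∀ x ∈ Icc a b, Real.cos x ≤ -c := by
  rcases (Icc a b).eq_empty_or_nonempty with he | hne
  · exact ⟨1, one_pos, by simp [he]⟩
  · obtain ⟨x, hx, hmax⟩ := isCompact_Icc.exists_isMaxOn hne Real.continuous_cos.continuousOn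
    refine ⟨-Real.cos x, ?_, fun y hy => by simpa using hmax hy⟩
    have := Real.cos_neg_of_pi_div_two_lt_of_lt (ha.trans_le hx.1)
      (by linarith [hx.2] : x < Real.pi + Real.pi / 2)
    linarith

/-- The exponential weight is integrable on a translated sector on which it decays. -/
lemma setLIntegral_sector_lt_top {ρ φ α β : ℝ} (hρ : 0 < ρ) (hα : Real.pi / 2 < φ + α)
    (hβ : φ + β < 3 * Real.pi / 2) (q : ℂ) {A : Set ℂ}
    (hA : A ⊆ (fun w => q + w) '' sector α β) :
    ∫⁻ w in A, ENNReal.ofReal (‖((ρ : ℂ) * Complex.exp ((φ : ℂ) * Complex.I)) *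
      Complex.exp (((ρ : ℂ) * Complex.exp ((φ : ℂ) * Complex.I)) * w)‖ ^ 2) < ⊤ := by
  obtain ⟨c, hc, hcos⟩ := exists_forall_cos_le_neg hα hβ
  set lam : ℂ := (ρ : ℂ) * Complex.exp ((φ : ℂ) * Complex.I) with hlam
  have hint : Integrable fun w : ℂ =>
      ‖lam‖ ^ 2 * Real.exp (2 * (lam * q).re) * Real.exp (-(2 * ρ * c) * ‖w - q‖) :=
    ((integrable_exp_neg_mul_norm (by positivity)).comp_sub_right q).const_mul _
  refine lt_of_le_of_lt ?_ hint.lintegral_lt_top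
  refine (setLIntegral_mono (by fun_prop) fun w hw => ?_).trans (setLIntegral_le_lintegral A _)
  obtain ⟨v, ⟨-, hv1, hv2⟩, rfl⟩ := hA hw
  refine ENNReal.ofReal_le_ofReal ?_
  have hre : (lam * (q + v)).re ≤ (lam * q).re + -(ρ * c) * ‖v‖ := by
    have h2 := hcos (φ + Complex.arg v) ⟨by linarith, by linarith⟩
    have h3 : 0 ≤ ρ * ‖v‖ := by positivity
    rw [mul_add, Complex.add_re, hlam, re_polar_mul ρ φ v]
    nlinarith
  simp only [add_sub_cancel_left]
  rw [norm_sq_mul_exp, mul_assoc (‖lam‖ ^ 2), ← Real.exp_add]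
  gcongr
  linarith

lemma volume_im_eq_zero : volume {w : ℂ | w.im = 0} = 0 := by
  have h := Measure.addHaar_submodule (volume : Measure ℂ) (LinearMap.ker Complex.imLm) ?_
  · exact h
  · intro htop
    have : Complex.I ∈ LinearMap.ker Complex.imLm := htop ▸ Submodule.mem_top
    simp at this

lemma mem_lower_or_mem_upper_or_im_eq_zero (w : ℂ) :
    w ∈ sector (-Real.pi) 0 ∨ w ∈ sector 0 Real.pi ∨ w.im = 0 := by
  rcases lt_trichotomy w.im 0 with hw | hw | hw
  · exact Or.inl ⟨by rintro rfl; simp at hw, Complex.neg_pi_lt_arg w, Complex.arg_neg_iff.2 hw⟩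
  · exact Or.inr (Or.inr hw)
  · refine Or.inr (Or.inl ⟨by rintro rfl; simp at hw, lt_of_le_of_ne
      (Complex.arg_nonneg_iff.2 hw.le) fun h => ?_, Complex.arg_lt_pi_iff.2 (Or.inr hw.ne')⟩)
    exact hw.ne' (Complex.arg_eq_zero_iff.1 h.symm).2

/-- If the exponential weight is integrable on a set containing a translated sector, then it does
not grow along any ray of that sector. -/
lemma cos_nonpos_of_setLIntegral_lt_top {ρ φ α β t : ℝ} (hρ : 0 < ρ) (hα : -Real.pi ≤ α)
    (hβ : β ≤ Real.pi) (ht : t ∈ Ioo α β) {q : ℂ} {A : Set ℂ}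
    (hA : (fun w => q + w) '' sector α β ⊆ A)
    (hfin : ∫⁻ w in A, ENNReal.ofReal (‖((ρ : ℂ) * Complex.exp ((φ : ℂ) * Complex.I)) *
      Complex.exp (((ρ : ℂ) * Complex.exp ((φ : ℂ) * Complex.I)) * w)‖ ^ 2) < ⊤) :
    Real.cos (φ + t) ≤ 0 := by
  by_contra! hpos
  set lam : ℂ := (ρ : ℂ) * Complex.exp ((φ : ℂ) * Complex.I) with hlam
  set u : ℂ := Complex.exp ((t : ℂ) * Complex.I) with hu
  have hlam0 : lam ≠ 0 := mul_ne_zero (by exact_mod_cast hρ.ne') (Complex.exp_ne_zero _)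
  have hu0 : u ≠ 0 := Complex.exp_ne_zero _
  have harg : Complex.arg u = t := by
    rw [hu, Complex.arg_exp_mul_I, toIocMod_eq_self]
    exact ⟨by linarith [ht.1], by linarith [ht.2, Real.pi_pos]⟩
  have hslit : u ∈ Complex.slitPlane := by
    rw [Complex.mem_slitPlane_iff_arg]
    exact ⟨by rw [harg]; linarith [ht.2], hu0⟩
  have hev : ∀ᶠ w in nhds u, w ∈ sector α β ∧ 0 < (lam * w).re := by
    have h1 := (Complex.continuousAt_arg hslit).eventually
      (Ioo_mem_nhds (harg.symm ▸ ht.1) (harg.symm ▸ ht.2))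
    have hcont : ContinuousAt (fun w : ℂ => (lam * w).re) u := by fun_prop
    have hre : 0 < (lam * u).re := by
      rw [hlam, re_polar_mul, harg, hu, Complex.norm_exp_ofReal_mul_I]
      positivity
    have h2 := hcont.eventually (lt_mem_nhds hre)
    filter_upwards [h1, h2, eventually_ne_nhds hu0] with w hw1 hw2 hw3
    exact ⟨⟨hw3, hw1.1, hw1.2⟩, hw2⟩
  obtain ⟨r, hr, hball⟩ := Metric.eventually_nhds_iff_ball.1 hev
  set K : ℝ≥0∞ := ENNReal.ofReal (‖lam * Complex.exp (lam * q)‖ ^ 2) *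
    (ENNReal.ofReal r ^ 2 * NNReal.pi) with hKdef
  have hK0 : K ≠ 0 := by
    have hpi : (NNReal.pi : ℝ≥0∞) ≠ 0 := by exact_mod_cast NNReal.pi_ne_zero
    simp [hKdef, hr, hpi, hlam0]
  obtain ⟨n, hn⟩ := ENNReal.exists_nat_mul_gt hK0 hfin.ne
  refine absurd hn (not_lt.2 ?_)
  rcases Nat.eq_zero_or_pos n with rfl | hn0
  · simp
  have hnR : (0 : ℝ) < n := by exact_mod_cast hn0
  have hpt : ∀ w ∈ ball (q + n * u) (n * r), w ∈ A ∧
      ‖lam * Complex.exp (lam * q)‖ ^ 2 ≤ ‖lam * Complex.exp (lam * w)‖ ^ 2 := by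
    intro w hw
    obtain ⟨v, rfl⟩ : ∃ v : ℂ, w = q + ((n : ℝ) : ℂ) * v :=
      ⟨(w - q) / n, by
        have : (n : ℂ) ≠ 0 := by exact_mod_cast hn0.ne'
        push_cast
        field_simp
        ring⟩
    have hv : v ∈ ball u r := by
      rw [mem_ball, dist_eq_norm] at hw ⊢
      have : q + ((n : ℝ) : ℂ) * v - (q + n * u) = (n : ℂ) * (v - u) := by push_cast; ring
      rw [this, norm_mul, Complex.norm_natCast] at hw
      exact lt_of_mul_lt_mul_left hw hnR.le
    obtain ⟨⟨hv0, hv1, hv2⟩, hvre⟩ := hball v hv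
    refine ⟨hA ⟨_, ⟨mul_ne_zero (by exact_mod_cast hnR.ne') hv0, ?_, ?_⟩, rfl⟩, ?_⟩
    · rwa [Complex.arg_real_mul _ hnR]
    · rwa [Complex.arg_real_mul _ hnR]
    · rw [norm_sq_mul_exp, norm_sq_mul_exp]
      have hle : (lam * q).re ≤ (lam * (q + ((n : ℝ) : ℂ) * v)).re := by
        rw [mul_add, Complex.add_re, mul_left_comm, Complex.re_ofReal_mul]
        linarith [mul_pos hnR hvre]
      gcongr ‖lam‖ ^ 2 * Real.exp (2 * ?_)
  calc (n : ℝ≥0∞) * K ≤ (n : ℝ≥0∞) ^ 2 * K := by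
        gcongr
        exact_mod_cast Nat.le_self_pow two_ne_zero n
    _ = ∫⁻ _ in ball (q + n * u) (n * r),
          ENNReal.ofReal (‖lam * Complex.exp (lam * q)‖ ^ 2) := by
        rw [setLIntegral_const, Complex.volume_ball, ENNReal.ofReal_mul hnR.le,
          ENNReal.ofReal_natCast, hKdef]
        ring
    _ ≤ ∫⁻ w in ball (q + n * u) (n * r),
          ENNReal.ofReal (‖lam * Complex.exp (lam * w)‖ ^ 2) :=
        setLIntegral_mono' measurableSet_ball fun w hw => ENNReal.ofReal_le_ofReal (hpt w hw).2
    _ ≤ _ := lintegral_mono_set fun w hw => (hpt w hw).1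

lemma lowerInnerArg_set_bddAbove (Ω : Set ℂ) : BddAbove ({0} ∪ {θ : ℝ | θ ∈ Ioc 0 Real.pi ∧
    ∃ q : ℂ, (fun w => q + w) '' sector (-θ) 0 ⊆ Ω ∩ sector (-Real.pi) 0}) := by
  refine ⟨Real.pi, ?_⟩
  rintro θ (rfl | ⟨hθ, -⟩)
  exacts [Real.pi_pos.le, hθ.2]

lemma upperInnerArg_set_bddAbove (Ω : Set ℂ) : BddAbove ({0} ∪ {θ : ℝ | θ ∈ Ioc 0 Real.pi ∧
    ∃ q : ℂ, (fun w => q + w) '' sector 0 θ ⊆ Ω ∩ sector 0 Real.pi}) := by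
  refine ⟨Real.pi, ?_⟩
  rintro θ (rfl | ⟨hθ, -⟩)
  exacts [Real.pi_pos.le, hθ.2]

lemma lowerInnerArg_nonneg (Ω : Set ℂ) : 0 ≤ lowerInnerArg Ω :=
  le_csSup (lowerInnerArg_set_bddAbove Ω) (Or.inl rfl)

lemma upperInnerArg_nonneg (Ω : Set ℂ) : 0 ≤ upperInnerArg Ω :=
  le_csSup (upperInnerArg_set_bddAbove Ω) (Or.inl rfl)

lemma exists_sector_subset_of_lt_lowerInnerArg {Ω : Set ℂ} {x : ℝ} (hx0 : 0 ≤ x)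
    (hx : x < lowerInnerArg Ω) : ∃ θ, x < θ ∧ θ ≤ Real.pi ∧
      ∃ q : ℂ, (fun w => q + w) '' sector (-θ) 0 ⊆ Ω := by
  obtain ⟨θ, rfl | ⟨hθ, q, hq⟩, hxθ⟩ := exists_lt_of_lt_csSup ((singleton_nonempty 0).inl) hx
  · exact absurd hxθ hx0.not_gt
  · exact ⟨θ, hxθ, hθ.2, q, hq.trans inter_subset_left⟩

lemma exists_sector_subset_of_lt_upperInnerArg {Ω : Set ℂ} {x : ℝ} (hx0 : 0 ≤ x)
    (hx : x < upperInnerArg Ω) : ∃ θ, x < θ ∧ θ ≤ Real.pi ∧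
      ∃ q : ℂ, (fun w => q + w) '' sector 0 θ ⊆ Ω := by
  obtain ⟨θ, rfl | ⟨hθ, q, hq⟩, hxθ⟩ := exists_lt_of_lt_csSup ((singleton_nonempty 0).inl) hx
  · exact absurd hxθ hx0.not_gt
  · exact ⟨θ, hxθ, hθ.2, q, hq.trans inter_subset_left⟩

lemma exists_subset_sector_of_lowerOuterArg_lt {Ω : Set ℂ} {x : ℝ} (hx : lowerOuterArg Ω < x) :
    ∃ θ < x, ∃ q : ℂ, Ω ∩ sector (-Real.pi) 0 ⊆ (fun w => q + w) '' sector (-θ) 0 := by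
  have hne : {θ : ℝ | θ ∈ Ioc 0 Real.pi ∧
      ∃ q : ℂ, Ω ∩ sector (-Real.pi) 0 ⊆ (fun w => q + w) '' sector (-θ) 0}.Nonempty :=
    ⟨Real.pi, ⟨Real.pi_pos, le_rfl⟩, 0, by simp⟩
  obtain ⟨θ, ⟨-, q, hq⟩, hθ⟩ := exists_lt_of_csInf_lt hne hx
  exact ⟨θ, hθ, q, hq⟩

lemma exists_subset_sector_of_upperOuterArg_lt {Ω : Set ℂ} {x : ℝ} (hx : upperOuterArg Ω < x) :
    ∃ θ < x, ∃ q : ℂ, Ω ∩ sector 0 Real.pi ⊆ (fun w => q + w) '' sector 0 θ := by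
  have hne : {θ : ℝ | θ ∈ Ioc 0 Real.pi ∧
      ∃ q : ℂ, Ω ∩ sector 0 Real.pi ⊆ (fun w => q + w) '' sector 0 θ}.Nonempty :=
    ⟨Real.pi, ⟨Real.pi_pos, le_rfl⟩, 0, by simp⟩
  obtain ⟨θ, ⟨-, q, hq⟩, hθ⟩ := exists_lt_of_csInf_lt hne hx
  exact ⟨θ, hθ, q, hq⟩

lemma cos_add_nonpos_of_Ioo {φ a b : ℝ} (hab : a < b)
    (h : ∀ t ∈ Ioo a b, Real.cos (φ + t) ≤ 0) : ∀ t ∈ Icc a b, Real.cos (φ + t) ≤ 0 := by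
  have hcl : IsClosed {t : ℝ | Real.cos (φ + t) ≤ 0} :=
    isClosed_le (by fun_prop) continuous_const
  rw [← closure_Ioo hab.ne]
  exact fun t ht => hcl.closure_subset_iff.2 h ht

lemma exists_polar_mem_Ico {lam : ℂ} (hlam : lam ≠ 0) :
    ∃ ρ : ℝ, 0 < ρ ∧ ∃ φ ∈ Ico 0 (2 * Real.pi),
      lam = (ρ : ℂ) * Complex.exp ((φ : ℂ) * Complex.I) := by
  refine ⟨‖lam‖, norm_pos_iff.2 hlam, ?_⟩
  have hl := Complex.norm_mul_exp_arg_mul_I lam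
  rcases le_or_gt 0 (Complex.arg lam) with h0 | h0
  · exact ⟨Complex.arg lam, ⟨h0, by linarith [Complex.arg_le_pi lam, Real.pi_pos]⟩, hl.symm⟩
  · refine ⟨Complex.arg lam + 2 * Real.pi,
      ⟨by linarith [Complex.neg_pi_lt_arg lam, Real.pi_pos], by linarith⟩, ?_⟩
    rw [← hl]
    push_cast
    rw [add_mul, Complex.exp_add, Complex.exp_two_pi_mul_I]
    simp

/-- **Theorem 1.4(b).** For a parabolic semigroup of zero hyperbolic step with Koenigs domain
`Ω ⊆ ℂ∖(-∞,0]`, if `θ_Ω⁻ = Θ_Ω⁻`, `θ_Ω⁺ = Θ_Ω⁺` and `θ_Ω = θ_Ω⁻ + θ_Ω⁺ ∈ (0,π)`, then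
`iS(θ_Ω⁻, π-θ_Ω⁺) ∪ {0} ⊆ σ_D ⊆ i·closure(S(θ_Ω⁻, π-θ_Ω⁺))`. -/
theorem dirichlet_spectrum_zhs_equal_args
    (Ω : Set ℂ) (hopen : IsOpen Ω) (hsc : SimplyConnectedSpace ↥Ω)
    (hslit : Ω ⊆ {w : ℂ | 0 < w.re ∨ w.im ≠ 0})
    (hconv : ConvexPosDir Ω)
    (hnohalf : ∀ c : ℝ, ¬ Ω ⊆ {w : ℂ | w.im < c} ∧ ¬ Ω ⊆ {w : ℂ | c < w.im})
    (h : ℂ → ℂ) (hKoenigs : IsKoenigsMap h Ω)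
    (hlow : lowerInnerArg Ω = lowerOuterArg Ω)
    (hup : upperInnerArg Ω = upperOuterArg Ω)
    (hsum_pos : 0 < lowerInnerArg Ω + upperInnerArg Ω)
    (hsum_pi : lowerInnerArg Ω + upperInnerArg Ω < Real.pi) :
    (∀ ρ : ℝ, 0 < ρ → ∀ φ : ℝ,
      Real.pi / 2 + lowerInnerArg Ω < φ → φ < 3 * Real.pi / 2 - upperInnerArg Ω →
      dirichletIntegral
        (fun z => Complex.exp (((ρ : ℂ) * Complex.exp ((φ : ℂ) * Complex.I)) * h z)) < ⊤) ∧
    (∀ lam : ℂ, lam ≠ 0 →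
      dirichletIntegral (fun z => Complex.exp (lam * h z)) < ⊤ →
      ∃ ρ : ℝ, 0 < ρ ∧ ∃ φ : ℝ,
        Real.pi / 2 + lowerInnerArg Ω ≤ φ ∧ φ ≤ 3 * Real.pi / 2 - upperInnerArg Ω ∧
        lam = (ρ : ℂ) * Complex.exp ((φ : ℂ) * Complex.I)) := by
  have ha := lowerInnerArg_nonneg Ω
  have hb := upperInnerArg_nonneg Ω
  refine ⟨fun ρ hρ φ hφ1 hφ2 => ?_, fun lam hlam hfin => ?_⟩
  · rw [dirichletIntegral_exp_mul hKoenigs]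
    obtain ⟨θ, hθ, q, hq⟩ := exists_subset_sector_of_lowerOuterArg_lt
      (show lowerOuterArg Ω < φ - Real.pi / 2 by linarith)
    obtain ⟨θ', hθ', q', hq'⟩ := exists_subset_sector_of_upperOuterArg_lt
      (show upperOuterArg Ω < 3 * Real.pi / 2 - φ by linarith)
    have hlower := setLIntegral_sector_lt_top (φ := φ) hρ (by linarith) (by linarith) q hq
    have hupper := setLIntegral_sector_lt_top (φ := φ) hρ (by linarith) (by linarith) q' hq'
    have hcover : Ω ⊆ (Ω ∩ sector (-Real.pi) 0) ∪ ((Ω ∩ sector 0 Real.pi) ∪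
        {w : ℂ | w.im = 0}) := fun w hw =>
      (mem_lower_or_mem_upper_or_im_eq_zero w).imp (⟨hw, ·⟩) (Or.imp_left (⟨hw, ·⟩))
    refine (lintegral_mono_set hcover).trans_lt ((lintegral_union_le _ _ _).trans_lt ?_)
    refine ENNReal.add_lt_top.2 ⟨hlower, (lintegral_union_le _ _ _).trans_lt
      (ENNReal.add_lt_top.2 ⟨hupper, ?_⟩)⟩
    rw [setLIntegral_measure_zero _ _ volume_im_eq_zero]
    exact ENNReal.zero_lt_top
  · rw [dirichletIntegral_exp_mul hKoenigs] at hfin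
    obtain ⟨ρ, hρ, φ, hφ, rfl⟩ := exists_polar_mem_Ico hlam
    have hcos_low : 0 < lowerInnerArg Ω →
        ∀ t ∈ Icc (-lowerInnerArg Ω) 0, Real.cos (φ + t) ≤ 0 := fun hpos =>
      cos_add_nonpos_of_Ioo (by linarith) fun t ht => by
        obtain ⟨θ, hθ, hθπ, q, hq⟩ := exists_sector_subset_of_lt_lowerInnerArg
          (show 0 ≤ -t by linarith [ht.2]) (show -t < lowerInnerArg Ω by linarith [ht.1])
        exact cos_nonpos_of_setLIntegral_lt_top hρ (by linarith) Real.pi_pos.le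
          ⟨by linarith, ht.2⟩ hq hfin
    have hcos_up : 0 < upperInnerArg Ω →
        ∀ t ∈ Icc 0 (upperInnerArg Ω), Real.cos (φ + t) ≤ 0 := fun hpos =>
      cos_add_nonpos_of_Ioo hpos fun t ht => by
        obtain ⟨θ, hθ, hθπ, q, hq⟩ := exists_sector_subset_of_lt_upperInnerArg ht.1.le ht.2
        exact cos_nonpos_of_setLIntegral_lt_top hρ (by linarith [Real.pi_pos]) hθπ
          ⟨ht.1, hθ⟩ hq hfin
    have hcos : Real.cos φ ≤ 0 := by
      rcases ha.eq_or_lt with h0 | h0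
      · simpa using hcos_up (by linarith) 0 ⟨le_rfl, hb⟩
      · simpa using hcos_low h0 0 ⟨by linarith, le_rfl⟩
    have hφ1 : Real.pi / 2 ≤ φ := by
      by_contra! hlt
      exact hcos.not_gt (Real.cos_pos_of_mem_Ioo ⟨by linarith [hφ.1, Real.pi_pos], hlt⟩)
    have hφ2 : φ ≤ 3 * Real.pi / 2 := by
      by_contra! hlt
      have := Real.cos_pos_of_mem_Ioo (x := φ - 2 * Real.pi)
        ⟨by linarith, by linarith [hφ.2, Real.pi_pos]⟩
      rw [Real.cos_sub_two_pi] at this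
      exact hcos.not_gt this
    refine ⟨ρ, hρ, φ, ?_, ?_, rfl⟩
    · rcases ha.eq_or_lt with h0 | h0
      · linarith
      · by_contra! hlt
        exact (hcos_low h0 _ ⟨le_rfl, by linarith⟩).not_gt
          (Real.cos_pos_of_mem_Ioo ⟨by linarith, by linarith⟩)
    · rcases hb.eq_or_lt with h0 | h0
      · linarith
      · by_contra! hlt
        have := Real.cos_pos_of_mem_Ioo (x := φ + upperInnerArg Ω - 2 * Real.pi)
          ⟨by linarith, by linarith⟩
        rw [Real.cos_sub_two_pi] at this
        exact (hcos_up h0 _ ⟨by linarith, le_rfl⟩).not_gt this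
end
end

section
/- Let Ω be a simply connected domain contained in the upper half-plane {Im w > 0}, convex in the positive direction and not contained in any horizontal strip, let h be a Koenigs map onto Ω, fix p ≥ 1 and α > -1, and suppose θ_Ω = Θ_Ω = θ for some θ ∈ (0,π). Then: (i) if λ = 0, or λ = ρ e^{iφ} with ρ > 0 and φ ∈ [π/2, 3π/2 - θ), then e^{λh} ∈ A_α^p; and (ii) if λ ≠ 0 and e^{λh} ∈ A_α^p, then λ = ρ e^{iφ} for some ρ > 0 and φ ∈ [π/2, 3π/2 - θ]. Equivalently, iS[0, π-θ) ∪ {0} ⊆ σ_{p,α} ⊆ i·closure(S(0, π-θ)). (Theorem 1.5(b) for the Bergman space.) -/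
open MeasureTheory Set Complex Metric
open scoped ENNReal NNReal

noncomputable section

/-- Membership in the weighted Bergman space `A_α^p`:
`∫_𝔻 |f(z)|^p (1-|z|²)^α dA(z) < ∞`. -/
def MemBergman (p α : ℝ) (f : ℂ → ℂ) : Prop :=
  ∫⁻ z in ball (0 : ℂ) 1,
    (‖f z‖₊ : ℝ≥0∞) ^ p * ENNReal.ofReal ((1 - ‖z‖ ^ 2) ^ α) < ⊤

/-- The inner argument `θ_Ω` of a domain contained in the upper half-plane. -/
def innerArg (Ω : Set ℂ) : ℝ :=
  sSup ({0} ∪ {θ : ℝ | θ ∈ Ioc 0 Real.pi ∧ ∃ q : ℂ, (fun w => q + w) '' sector 0 θ ⊆ Ω})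

/-- The outer argument `Θ_Ω` of a domain contained in the upper half-plane. -/
def outerArg (Ω : Set ℂ) : ℝ :=
  sInf {θ : ℝ | θ ∈ Ioc 0 Real.pi ∧ ∃ q : ℂ, Ω ⊆ (fun w => q + w) '' sector 0 θ}

open Filter Topology

theorem setLIntegral_one_sub_norm_sq_rpow_lt_top {α : ℝ} (hα : -1 < α) :
    ∫⁻ z in ball (0 : ℂ) 1, ENNReal.ofReal ((1 - ‖z‖ ^ 2) ^ α) < ⊤ := by
  have hint : IntegrableOn (fun r : ℝ ↦ (1 - r) ^ α) (Ioo 0 1) := by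
    have h := (intervalIntegral.intervalIntegrable_rpow' (a := 0) (b := 1) hα).comp_sub_left 1
    simp only [sub_zero, sub_self] at h
    exact ((intervalIntegrable_iff_integrableOn_Ioc_of_le zero_le_one).1 h.symm).mono_set
      Ioo_subset_Ioc_self
  have hrad : IntegrableOn (fun r : ℝ ↦ r ^ (Module.finrank ℝ ℂ - 1) • (1 - r ^ 2) ^ α)
      (Ioo 0 1) := by
    refine Integrable.mono' (hint.const_mul (2 ^ |α|)) (by fun_prop) ?_
    filter_upwards [ae_restrict_mem measurableSet_Ioo] with r hr
    have h1 : 0 < 1 - r := by linarith [hr.2]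
    have h2 : 0 < 1 + r := by linarith [hr.1]
    have hfac : (1 - r ^ 2) ^ α = (1 + r) ^ α * (1 - r) ^ α := by
      rw [← Real.mul_rpow h2.le h1.le]; ring_nf
    have hle : (1 + r) ^ α ≤ 2 ^ |α| :=
      (Real.rpow_le_rpow_of_exponent_le (by linarith [hr.1]) (le_abs_self α)).trans
        (Real.rpow_le_rpow h2.le (by linarith [hr.2]) (abs_nonneg α))
    rw [Complex.finrank_real_complex, hfac, smul_eq_mul, Real.norm_of_nonneg
      (mul_nonneg (pow_nonneg hr.1.le _) (by positivity))]
    calc r ^ (2 - 1) * ((1 + r) ^ α * (1 - r) ^ α)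
        ≤ 1 * ((1 + r) ^ α * (1 - r) ^ α) := by
          gcongr
          simpa using hr.2.le
      _ ≤ 2 ^ |α| * (1 - r) ^ α := by
          rw [one_mul]; gcongr
  have h := (integrableOn_fun_norm_addHaar (E := ℂ) volume
    (f := fun r ↦ (1 - r ^ 2) ^ α) (r := 1)).2 hrad
  exact h.lintegral_lt_top

theorem memBergman_of_bounded {p α : ℝ} (hp : 0 ≤ p) (hα : -1 < α) {f : ℂ → ℂ} {C : ℝ}
    (hf : ∀ z ∈ ball (0 : ℂ) 1, ‖f z‖ ≤ C) : MemBergman p α f := by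
  unfold MemBergman
  calc _ ≤ ∫⁻ z in ball (0 : ℂ) 1,
        ENNReal.ofReal C ^ p * ENNReal.ofReal ((1 - ‖z‖ ^ 2) ^ α) := by
        refine setLIntegral_mono' measurableSet_ball fun z hz ↦ ?_
        gcongr
        rw [← ENNReal.ofReal_coe_nnreal]
        exact ENNReal.ofReal_le_ofReal (hf z hz)
    _ = ENNReal.ofReal C ^ p * ∫⁻ z in ball (0 : ℂ) 1, ENNReal.ofReal ((1 - ‖z‖ ^ 2) ^ α) :=
        lintegral_const_mul' _ _ (ENNReal.rpow_ne_top_of_nonneg hp ENNReal.ofReal_ne_top)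
    _ < ⊤ := ENNReal.mul_lt_top
        (ENNReal.rpow_lt_top_of_nonneg hp ENNReal.ofReal_ne_top)
        (setLIntegral_one_sub_norm_sq_rpow_lt_top hα)

theorem enorm_center_le_setLIntegral_circle {G : ℂ → ℂ} {c : ℂ} {r : ℝ} (hr : 0 ≤ r)
    (hG : DiffContOnCl ℂ G (ball c r)) :
    ‖G c‖ₑ ≤ ∫⁻ t in Ioo (-Real.pi) Real.pi, ‖G (circleMap c r t)‖ₑ := by
  have hmean : G c = (2 * Real.pi)⁻¹ • ∫ t in (-Real.pi)..Real.pi, G (circleMap c r t) := by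
    have h : Real.circleAverage G c r = G c :=
      DiffContOnCl.circleAverage (by rwa [abs_of_nonneg hr])
    rw [← h, Real.circleAverage_eq_integral_add (-Real.pi)]
    congr 1
    rw [intervalIntegral.integral_comp_add_right (fun t ↦ G (circleMap c r t))]
    congr 1 <;> ring
  have hpi : -Real.pi ≤ Real.pi := by linarith [Real.pi_pos]
  rw [intervalIntegral.integral_of_le hpi, integral_Ioc_eq_integral_Ioo] at hmean
  calc ‖G c‖ₑ = ‖(2 * Real.pi)⁻¹‖ₑ * ‖∫ t in Ioo (-Real.pi) Real.pi, G (circleMap c r t)‖ₑ := by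
        rw [← enorm_smul, ← hmean]
    _ ≤ 1 * ∫⁻ t in Ioo (-Real.pi) Real.pi, ‖G (circleMap c r t)‖ₑ := by
        gcongr
        · rw [← ofReal_norm, ENNReal.ofReal_le_one, norm_inv, Real.norm_of_nonneg (by positivity)]
          exact inv_le_one_of_one_le₀ (by linarith [Real.pi_gt_three])
        · exact enorm_integral_le_lintegral_enorm _
    _ = _ := one_mul _

theorem ofReal_sq_mul_enorm_le_setLIntegral {G : ℂ → ℂ} {c : ℂ} {R : ℝ} (hR : 0 < R)
    (hG : DifferentiableOn ℂ G (ball c R)) :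
    ENNReal.ofReal (R / 2) ^ 2 * ‖G c‖ₑ ≤ ∫⁻ z in ball c R, ‖G z‖ₑ := by
  have hcirc : ∀ x : ℝ × ℝ, c + Complex.polarCoord.symm x = circleMap c x.1 x.2 := fun x ↦ by
    rw [Complex.polarCoord_symm_apply, circleMap, Complex.exp_mul_I]; push_cast; rfl
  have hpolar : ∫⁻ z in ball c R, ‖G z‖ₑ =
      ∫⁻ x in polarCoord.target, ENNReal.ofReal x.1 •
        (ball c R).indicator (fun z ↦ ‖G z‖ₑ) (circleMap c x.1 x.2) := by
    rw [← lintegral_indicator measurableSet_ball,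
      ← lintegral_add_left_eq_self _ c, ← Complex.lintegral_comp_polarCoord_symm]
    simp_rw [hcirc]
  have hmem : ∀ x ∈ Ioo (R / 2) R ×ˢ Ioo (-Real.pi) Real.pi, circleMap c x.1 x.2 ∈ ball c R := by
    rintro x ⟨hx, -⟩
    rw [mem_ball, dist_eq_norm, circleMap_sub_center, norm_circleMap_zero,
      abs_of_pos (by linarith [hx.1])]
    exact hx.2
  have hmeas : AEMeasurable (fun x : ℝ × ℝ ↦ ‖G (circleMap c x.1 x.2)‖ₑ)
      ((volume.prod volume).restrict (Ioo (R / 2) R ×ˢ Ioo (-Real.pi) Real.pi)) := by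
    refine (ContinuousOn.enorm ?_).aemeasurable (measurableSet_Ioo.prod measurableSet_Ioo)
    refine hG.continuousOn.comp (Continuous.continuousOn ?_) hmem
    unfold circleMap
    fun_prop
  calc ENNReal.ofReal (R / 2) ^ 2 * ‖G c‖ₑ
      = ENNReal.ofReal (R / 2) * ∫⁻ _ in Ioo (R / 2) R, ‖G c‖ₑ := by
        rw [setLIntegral_const, Real.volume_Ioo, sub_half]; ring
    _ ≤ ENNReal.ofReal (R / 2) * ∫⁻ r in Ioo (R / 2) R,
          ∫⁻ t in Ioo (-Real.pi) Real.pi, ‖G (circleMap c r t)‖ₑ := by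
        refine mul_le_mul_right (setLIntegral_mono' measurableSet_Ioo fun r hr ↦ ?_) _
        refine enorm_center_le_setLIntegral_circle (by linarith [hr.1]) ?_
        exact (hG.mono (closedBall_subset_ball hr.2)).diffContOnCl_ball subset_rfl
    _ = ENNReal.ofReal (R / 2) * ∫⁻ x in Ioo (R / 2) R ×ˢ Ioo (-Real.pi) Real.pi,
          ‖G (circleMap c x.1 x.2)‖ₑ := by
        rw [Measure.volume_eq_prod, setLIntegral_prod _ hmeas]
    _ = ∫⁻ x in Ioo (R / 2) R ×ˢ Ioo (-Real.pi) Real.pi,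
          ENNReal.ofReal (R / 2) * ‖G (circleMap c x.1 x.2)‖ₑ :=
        (lintegral_const_mul' _ _ ENNReal.ofReal_ne_top).symm
    _ ≤ ∫⁻ x in Ioo (R / 2) R ×ˢ Ioo (-Real.pi) Real.pi, ENNReal.ofReal x.1 •
          (ball c R).indicator (fun z ↦ ‖G z‖ₑ) (circleMap c x.1 x.2) := by
        refine setLIntegral_mono' (measurableSet_Ioo.prod measurableSet_Ioo) fun x hx ↦ ?_
        rw [indicator_of_mem (hmem x hx), smul_eq_mul]
        gcongr
        exact hx.1.1.le
    _ ≤ _ := by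
        rw [hpolar]
        refine lintegral_mono_set (prod_mono (fun r hr ↦ ?_) subset_rfl)
        exact (half_pos hR).trans hr.1

theorem exists_norm_mul_pow_le_of_setLIntegral_lt_top {α : ℝ} {G : ℂ → ℂ}
    (hG : DifferentiableOn ℂ G (ball 0 1))
    (hfin : ∫⁻ z in ball (0 : ℂ) 1, ‖G z‖ₑ * ENNReal.ofReal ((1 - ‖z‖ ^ 2) ^ α) < ⊤) :
    ∃ C : ℝ, ∃ N : ℕ, ∀ z ∈ ball (0 : ℂ) 1, ‖G z‖ * (1 - ‖z‖) ^ N ≤ C := by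
  obtain ⟨N, hN⟩ := exists_nat_ge α
  set I := ∫⁻ z in ball (0 : ℂ) 1, ‖G z‖ₑ * ENNReal.ofReal ((1 - ‖z‖ ^ 2) ^ α) with hI
  refine ⟨4 ^ (N + 2) * I.toReal, N + 2, fun z hz ↦ ?_⟩
  have hz1 : ‖z‖ < 1 := mem_ball_zero_iff.1 hz
  set s := (1 - ‖z‖) / 2 with hs
  have hs0 : 0 < s := by linarith
  have hball : ∀ w ∈ ball z s, ‖w‖ < 1 - s := fun w hw ↦ by
    have h1 := norm_le_norm_add_norm_sub' w z
    have h2 : ‖w - z‖ < s := mem_ball_iff_norm.1 hw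
    linarith
  have hsub : ball z s ⊆ ball 0 1 := fun w hw ↦ by
    rw [mem_ball_zero_iff]; linarith [hball w hw]
  have key : ENNReal.ofReal (s ^ N) * (ENNReal.ofReal (s / 2) ^ 2 * ‖G z‖ₑ) ≤ I := by
    calc _ ≤ ENNReal.ofReal (s ^ N) * ∫⁻ w in ball z s, ‖G w‖ₑ := by
          gcongr
          exact ofReal_sq_mul_enorm_le_setLIntegral hs0 (hG.mono hsub)
      _ = ∫⁻ w in ball z s, ENNReal.ofReal (s ^ N) * ‖G w‖ₑ :=
          (lintegral_const_mul' _ _ ENNReal.ofReal_ne_top).symm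
      _ ≤ ∫⁻ w in ball z s, ‖G w‖ₑ * ENNReal.ofReal ((1 - ‖w‖ ^ 2) ^ α) := by
          refine setLIntegral_mono' measurableSet_ball fun w hw ↦ ?_
          rw [mul_comm]
          have hw1 := hball w hw
          have hw0 := norm_nonneg w
          have hbase : s ≤ 1 - ‖w‖ ^ 2 := by nlinarith
          gcongr
          calc s ^ N ≤ (1 - ‖w‖ ^ 2) ^ N := by gcongr
            _ = (1 - ‖w‖ ^ 2) ^ (N : ℝ) := (Real.rpow_natCast _ _).symm
            _ ≤ (1 - ‖w‖ ^ 2) ^ α :=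
              Real.rpow_le_rpow_of_exponent_ge (hs0.trans_le hbase) (by nlinarith) hN
      _ ≤ I := lintegral_mono_set hsub
  have key' := ENNReal.toReal_mono hfin.ne key
  rw [ENNReal.toReal_mul, ENNReal.toReal_mul, ENNReal.toReal_pow,
    ENNReal.toReal_ofReal (by positivity), ENNReal.toReal_ofReal (by positivity),
    toReal_enorm] at key'
  have h1 : 1 - ‖z‖ = 2 * s := by rw [hs]; ring
  calc ‖G z‖ * (1 - ‖z‖) ^ (N + 2)
      = 2 ^ (N + 4) * (s ^ N * ((s / 2) ^ 2 * ‖G z‖)) := by rw [h1, mul_pow]; ring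
    _ ≤ 4 ^ (N + 2) * I.toReal := by
        gcongr
        rw [show (4 : ℝ) = 2 ^ 2 by norm_num, ← pow_mul]
        exact pow_le_pow_right₀ (by norm_num) (by omega)

theorem differentiableOn_leftInverse_of_injOn {U : Set ℂ} (hU : IsOpen U) {h g : ℂ → ℂ}
    (hd : DifferentiableOn ℂ h U) (hinj : InjOn h U) (hg : LeftInvOn g h U) :
    DifferentiableOn ℂ g (h '' U) := by
  have hne : ∀ z ∈ U, ¬ ∀ᶠ y in 𝓝 z, h y = h z := fun z hz hc ↦ by
    have h1 : ∀ᶠ y in 𝓝[≠] z, y = z := by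
      filter_upwards [nhdsWithin_le_nhds hc, nhdsWithin_le_nhds (hU.mem_nhds hz)] with y hy hyU
      exact hinj hyU hz hy
    obtain ⟨y, hy, hyz⟩ := (h1.and self_mem_nhdsWithin).exists
    exact hyz hy
  have hopen : ∀ z ∈ U, 𝓝 (h z) ≤ map h (𝓝 z) := fun z hz ↦
    ((hd.analyticAt (hU.mem_nhds hz)).eventually_constant_or_nhds_le_map_nhds).resolve_left
      (hne z hz)
  have hcont : ∀ z ∈ U, ContinuousAt g (h z) := fun z hz ↦ by
    rw [ContinuousAt, hg hz]
    refine Tendsto.mono_left ?_ (hopen z hz)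
    rw [tendsto_map'_iff]
    refine tendsto_id.congr' ?_
    filter_upwards [hU.mem_nhds hz] with y hy using (hg hy).symm
  have himage : IsOpen (h '' U) := by
    rw [isOpen_iff_mem_nhds]
    rintro _ ⟨z, hz, rfl⟩
    exact hopen z hz (image_mem_map (hU.mem_nhds hz))
  have hright : ∀ w ∈ h '' U, h (g w) = w := by
    rintro _ ⟨z, hz, rfl⟩
    rw [hg hz]
  rintro _ ⟨z, hz, rfl⟩
  refine (analyticAt_of_differentiable_on_punctured_nhds_of_continuousAt ?_
    (hcont z hz)).differentiableAt.differentiableWithinAt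
  have hderiv : ∀ᶠ y in 𝓝[≠] z, deriv h y ≠ 0 := by
    refine ((hd.analyticAt (hU.mem_nhds hz)).deriv.eventually_eq_zero_or_eventually_ne_zero
      ).resolve_left fun h0 ↦ hne z hz ?_
    obtain ⟨ε, hε, hball⟩ := Metric.eventually_nhds_iff_ball.1 (h0.and (hU.mem_nhds hz))
    filter_upwards [ball_mem_nhds z hε] with y hy
    refine (convex_ball z ε).is_const_of_fderivWithin_eq_zero (𝕜 := ℂ)
      (hd.mono fun x hx ↦ (hball x hx).2) (fun x hx ↦ ?_) hy (mem_ball_self hε)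
    rw [fderivWithin_of_isOpen isOpen_ball hx]
    ext
    simpa using (hball x hx).1
  have hg_tendsto : Tendsto g (𝓝[≠] (h z)) (𝓝[≠] z) := by
    refine tendsto_nhdsWithin_iff.2 ⟨?_, ?_⟩
    · have := hcont z hz
      rw [ContinuousAt, hg hz] at this
      exact this.mono_left nhdsWithin_le_nhds
    · filter_upwards [self_mem_nhdsWithin,
        nhdsWithin_le_nhds (himage.mem_nhds (mem_image_of_mem h hz))] with w hw hwU hgw
      exact hw (by rw [← hright w hwU, hgw]; rfl)
  filter_upwards [hg_tendsto.eventually hderiv,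
    nhdsWithin_le_nhds (himage.mem_nhds (mem_image_of_mem h hz))] with w hw hwU
  obtain ⟨y, hy, rfl⟩ := hwU
  rw [hg hy] at hw
  refine (HasDerivAt.of_local_left_inverse (f := h) (hcont y hy) ?_ hw ?_).differentiableAt
  · rw [hg hy]
    exact (hd.differentiableAt (hU.mem_nhds hy)).hasDerivAt
  · filter_upwards [himage.mem_nhds (mem_image_of_mem h hy)] using hright

theorem one_sub_norm_le_three_mul {g : ℂ → ℂ} {c w : ℂ} {R : ℝ} (hR : 0 < R)
    (hd : DifferentiableOn ℂ g (ball c R)) (hg : MapsTo g (ball c R) (ball 0 1))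
    (hw : ‖w - c‖ ≤ R / 2) : 1 - ‖g w‖ ≤ 3 * (1 - ‖g c‖) := by
  obtain ⟨η, hη, hηc⟩ : ∃ η : ℂ, ‖η‖ = 1 ∧ η * g c = ‖g c‖ := by
    rcases eq_or_ne (g c) 0 with h0 | h0
    · exact ⟨1, by simp, by simp [h0]⟩
    · have hn : (‖g c‖ : ℂ) ≠ 0 := by simpa using h0
      refine ⟨‖g c‖ / g c, ?_, by field_simp⟩
      rw [norm_div, norm_real, norm_norm, div_self (norm_ne_zero_iff.2 h0)]
  set f : ℂ → ℂ := fun ζ ↦ η * g (c + ζ) - 1 with hf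
  have hmem : ∀ ζ ∈ ball (0 : ℂ) R, c + ζ ∈ ball c R := fun ζ hζ ↦ by simpa using hζ
  have hfd : DifferentiableOn ℂ f (ball 0 R) :=
    ((hd.comp (by fun_prop) hmem).const_mul η).sub_const 1
  have hre : ∀ ζ ∈ ball (0 : ℂ) R, (f ζ).re ≤ 0 := fun ζ hζ ↦ by
    have h1 : ‖g (c + ζ)‖ < 1 := mem_ball_zero_iff.1 (hg (hmem ζ hζ))
    have h2 := re_le_norm (η * g (c + ζ))
    rw [norm_mul, hη, one_mul] at h2
    simp only [hf, sub_re, one_re]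
    linarith
  have hwb : w - c ∈ ball (0 : ℂ) R := by
    rw [mem_ball_zero_iff]; linarith
  have hgc : ‖g c‖ < 1 := mem_ball_zero_iff.1 (hg (mem_ball_self hR))
  have hf0 : ‖f 0‖ = 1 - ‖g c‖ := by
    simp only [hf, add_zero, hηc]
    rw [← ofReal_one, ← ofReal_sub, norm_real, Real.norm_eq_abs, abs_sub_comm,
      abs_of_pos (by linarith)]
  have hfw : 1 - ‖g w‖ ≤ ‖f (w - c)‖ := by
    have := norm_sub_norm_le 1 (η * g w)
    rw [norm_mul, hη, one_mul, norm_one, norm_sub_rev] at this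
    simpa [hf] using this
  refine hfw.trans (le_of_forall_pos_le_add fun ε hε ↦ ?_)
  have hBC := borelCaratheodory (M := ε / 2) (by positivity) hfd
    (fun ζ hζ ↦ (hre ζ hζ).trans (by positivity)) hR hwb
  have hnn := norm_nonneg (w - c)
  have hden : 0 < R - ‖w - c‖ := by linarith
  refine hBC.trans ?_
  rw [hf0, ← add_div, div_le_iff₀ hden]
  nlinarith [mul_nonneg hε.le (sub_nonneg.2 hw), mul_nonneg (sub_pos.2 hgc).le (sub_nonneg.2 hw)]

theorem not_forall_exp_const_mul_pow_le {a B C K t : ℝ} (ha : 0 < a) (hB : 0 < B) (ht : 1 < t)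
    (hK : 0 < K) : ¬ ∀ n : ℕ, a * Real.exp (B * t ^ n) ≤ C * K ^ n := by
  intro hle
  obtain ⟨m, hm⟩ := pow_unbounded_of_one_lt (2 * K) ht
  set D := a * (B ^ m / m.factorial) with hD
  have hD0 : 0 < D := by positivity
  obtain ⟨n, hn⟩ := pow_unbounded_of_one_lt (C / D) (one_lt_two (α := ℝ))
  have h1 : D * (2 * K) ^ n ≤ C * K ^ n := by
    refine le_trans ?_ (hle n)
    calc D * (2 * K) ^ n ≤ D * (t ^ m) ^ n := by gcongr
      _ = a * ((B * t ^ n) ^ m / m.factorial) := by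
        rw [hD, mul_pow, ← pow_mul, ← pow_mul, mul_comm m n]; ring
      _ ≤ a * Real.exp (B * t ^ n) := by
        gcongr
        exact Real.pow_div_factorial_le_exp _ (by positivity) m
  rw [mul_pow, ← mul_assoc] at h1
  have h2 : D * 2 ^ n ≤ C := le_of_mul_le_mul_right h1 (by positivity)
  rw [div_lt_iff₀ hD0] at hn
  linarith

theorem not_memBergman_exp_of_cone {h : ℂ → ℂ} (hd : DifferentiableOn ℂ h (ball 0 1))
    (hinj : InjOn h (ball 0 1)) {p α δ : ℝ} (hp : 0 < p) (hδ : 0 < δ) {q u lam : ℂ}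
    (hu : ‖u‖ = 1) (hcone : ∀ r : ℝ, 0 < r → ball (q + r * u) (r * δ) ⊆ h '' ball 0 1)
    (hlam : 0 < (lam * u).re) : ¬ MemBergman p α (fun z ↦ exp (lam * h z)) := by
  intro hmem
  set g := Function.invFunOn h (ball 0 1) with hg
  have hgd : DifferentiableOn ℂ g (h '' ball 0 1) :=
    differentiableOn_leftInverse_of_injOn isOpen_ball hd hinj hinj.leftInvOn_invFunOn
  have hgmaps : MapsTo g (h '' ball 0 1) (ball 0 1) := fun w hw ↦ Function.invFunOn_mem hw
  have hgright : ∀ w ∈ h '' ball 0 1, h (g w) = w := fun w hw ↦ Function.invFunOn_eq hw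
  have hGd : DifferentiableOn ℂ (fun z ↦ exp (p * lam * h z)) (ball 0 1) :=
    (hd.const_mul (p * lam)).cexp
  have hfin : ∫⁻ z in ball (0 : ℂ) 1,
      ‖exp (p * lam * h z)‖ₑ * ENNReal.ofReal ((1 - ‖z‖ ^ 2) ^ α) < ⊤ := by
    refine lt_of_eq_of_lt (lintegral_congr fun z ↦ ?_) hmem
    congr 1
    rw [← enorm_eq_nnnorm, ← ofReal_norm, ← ofReal_norm, norm_exp, norm_exp,
      ENNReal.ofReal_rpow_of_pos (Real.exp_pos _), ← Real.exp_mul, mul_assoc, re_ofReal_mul,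
      mul_comm p]
  obtain ⟨C, N, hC⟩ := exists_norm_mul_pow_le_of_setLIntegral_lt_top hGd hfin
  set t := 1 + δ / 2 with ht
  have ht1 : 1 < t := by linarith
  have ht0 : 0 < t := by linarith
  set w : ℕ → ℂ := fun n ↦ q + (t ^ n : ℝ) * u with hw
  have hwmem : ∀ n, w n ∈ h '' ball 0 1 := fun n ↦
    hcone (t ^ n) (by positivity) (mem_ball_self (by positivity))
  have hstep : ∀ n, 1 - ‖g (w n)‖ ≤ 3 * (1 - ‖g (w (n + 1))‖) := fun n ↦ by
    have hsub := hcone (t ^ (n + 1)) (by positivity)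
    refine one_sub_norm_le_three_mul (R := t ^ (n + 1) * δ) (by positivity) (hgd.mono hsub)
      (hgmaps.mono_left hsub) ?_
    have hdiff : w n - w (n + 1) = ((t ^ n - t ^ (n + 1) : ℝ) : ℂ) * u := by
      simp only [hw]; push_cast; ring
    have hle : t ^ n ≤ t ^ (n + 1) := pow_le_pow_right₀ ht1.le n.le_succ
    rw [hdiff, norm_mul, hu, mul_one, norm_real, Real.norm_eq_abs, abs_sub_comm,
      abs_of_nonneg (sub_nonneg.2 hle)]
    calc t ^ (n + 1) - t ^ n = t ^ n * δ / 2 := by rw [ht, pow_succ]; ring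
      _ ≤ t ^ (n + 1) * δ / 2 := by gcongr
  have hiter : ∀ n, 1 - ‖g (w 0)‖ ≤ 3 ^ n * (1 - ‖g (w n)‖) := fun n ↦ by
    induction n with
    | zero => simp
    | succ k ih =>
      refine ih.trans ?_
      rw [pow_succ, mul_assoc]
      gcongr
      exact hstep k
  have hs0 : 0 < 1 - ‖g (w 0)‖ := sub_pos.2 (mem_ball_zero_iff.1 (hgmaps (hwmem 0)))
  refine not_forall_exp_const_mul_pow_le (C := C) (K := 3 ^ N)
    (a := Real.exp (p * (lam * q).re) * (1 - ‖g (w 0)‖) ^ N) (B := p * (lam * u).re)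
    (by positivity) (by positivity) ht1 (by positivity) fun n ↦ ?_
  have hre : (p * lam * w n).re = p * (lam * q).re + p * (lam * u).re * t ^ n := by
    have : p * lam * w n = (p : ℂ) * (lam * q) + (p : ℂ) * ((t ^ n : ℝ) * (lam * u)) := by
      simp only [hw]; ring
    rw [this, add_re, re_ofReal_mul, re_ofReal_mul, re_ofReal_mul]; ring
  have hCn := hC _ (hgmaps (hwmem n))
  simp only [hgright _ (hwmem n), norm_exp, hre, Real.exp_add] at hCn
  calc _ ≤ Real.exp (p * (lam * q).re) * (3 ^ n * (1 - ‖g (w n)‖)) ^ N *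
        Real.exp (p * (lam * u).re * t ^ n) := by
        gcongr
        exact hiter n
    _ = Real.exp (p * (lam * q).re) * Real.exp (p * (lam * u).re * t ^ n) *
        (1 - ‖g (w n)‖) ^ N * (3 ^ N) ^ n := by
        rw [mul_pow, ← pow_mul, ← pow_mul, mul_comm n N]; ring
    _ ≤ C * (3 ^ N) ^ n := by gcongr

theorem isOpen_sector_zero {b : ℝ} (hb : b ≤ Real.pi) : IsOpen (sector 0 b) := by
  rw [isOpen_iff_mem_nhds]
  rintro w ⟨hw, h0, h1⟩
  have harg : ContinuousAt arg w :=
    continuousAt_arg (mem_slitPlane_iff_arg.2 ⟨(h1.trans_le hb).ne, hw⟩)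
  filter_upwards [isOpen_ne.mem_nhds hw, harg.eventually_mem (Ioo_mem_nhds h0 h1)] with v hv hva
  exact ⟨hv, hva⟩

theorem real_mul_mem_sector {a b r : ℝ} (hr : 0 < r) {w : ℂ} (hw : w ∈ sector a b) :
    (r : ℂ) * w ∈ sector a b :=
  ⟨mul_ne_zero (ofReal_ne_zero.2 hr.ne') hw.1, by
    rw [arg_real_mul w hr]; exact hw.2⟩

theorem exists_ball_subset_add_sector {b : ℝ} (hb : b ≤ Real.pi) {u : ℂ} (hu : u ∈ sector 0 b)
    (q : ℂ) : ∃ δ : ℝ, 0 < δ ∧ ∀ r : ℝ, 0 < r →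
      ball (q + r * u) (r * δ) ⊆ (fun w ↦ q + w) '' sector 0 b := by
  obtain ⟨δ, hδ, hsub⟩ := Metric.isOpen_iff.1 (isOpen_sector_zero hb) u hu
  refine ⟨δ, hδ, fun r hr x hx ↦ ⟨r * ((x - q) / r), real_mul_mem_sector hr (hsub ?_), ?_⟩⟩
  · have hr' : (r : ℂ) ≠ 0 := ofReal_ne_zero.2 hr.ne'
    rw [mem_ball_iff_norm] at hx ⊢
    have : x - (q + r * u) = r * ((x - q) / r - u) := by field_simp; ring
    rw [this, norm_mul, norm_real, Real.norm_of_nonneg hr.le] at hx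
    exact lt_of_mul_lt_mul_left hx hr.le
  · have hr' : (r : ℂ) ≠ 0 := ofReal_ne_zero.2 hr.ne'
    dsimp only
    field_simp
    ring

theorem re_mul_exp_mul_eq (ρ φ : ℝ) (v : ℂ) :
    ((ρ : ℂ) * exp (φ * I) * v).re = ρ * ‖v‖ * Real.cos (φ + arg v) := by
  conv_lhs => rw [← norm_mul_exp_arg_mul_I v]
  have : (ρ : ℂ) * exp (φ * I) * (‖v‖ * exp (arg v * I)) =
      ((ρ * ‖v‖ : ℝ) : ℂ) * exp ((φ + arg v : ℝ) * I) := by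
    push_cast; rw [add_mul, exp_add]; ring
  rw [this, re_ofReal_mul, exp_ofReal_mul_I_re]

theorem exists_polar_angle_ge_pi_div_two {lam : ℂ} (hlam : lam ≠ 0) :
    ∃ ρ : ℝ, 0 < ρ ∧ ∃ φ : ℝ, Real.pi / 2 ≤ φ ∧ φ < 5 * Real.pi / 2 ∧
      lam = (ρ : ℂ) * exp (φ * I) := by
  refine ⟨‖lam‖, norm_pos_iff.2 hlam, ?_⟩
  have hpi := Real.pi_pos
  rcases le_or_gt (Real.pi / 2) (arg lam) with h | h
  · exact ⟨arg lam, h, by linarith [arg_le_pi lam], (norm_mul_exp_arg_mul_I lam).symm⟩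
  · refine ⟨arg lam + 2 * Real.pi, by linarith [neg_pi_lt_arg lam], by linarith, ?_⟩
    push_cast
    rw [add_mul, exp_add, exp_two_pi_mul_I, mul_one, norm_mul_exp_arg_mul_I]

/-- **Theorem 1.5(b), Bergman case.** For a parabolic semigroup of positive hyperbolic step with
Koenigs domain `Ω` in the upper half-plane and `θ_Ω = Θ_Ω = θ ∈ (0,π)`, one has
`iS[0, π-θ) ∪ {0} ⊆ σ_{p,α} ⊆ i·closure(S(0, π-θ))`. -/
theorem bergman_spectrum_phs_equal_args
    (Ω : Set ℂ) (hopen : IsOpen Ω) (hsc : SimplyConnectedSpace ↥Ω)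
    (hupper : Ω ⊆ {w : ℂ | 0 < w.im})
    (hconv : ConvexPosDir Ω)
    (hnostrip : ∀ a b : ℝ, ¬ Ω ⊆ {w : ℂ | a < w.im ∧ w.im < b})
    (h : ℂ → ℂ) (hKoenigs : IsKoenigsMap h Ω)
    (p α : ℝ) (hp : 1 ≤ p) (hα : -1 < α)
    (θ : ℝ) (hθpos : 0 < θ) (hθpi : θ < Real.pi)
    (hinner : innerArg Ω = θ) (houter : outerArg Ω = θ) :
    (∀ lam : ℂ,
      (lam = 0 ∨ ∃ ρ : ℝ, 0 < ρ ∧ ∃ φ : ℝ, Real.pi / 2 ≤ φ ∧ φ < 3 * Real.pi / 2 - θ ∧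
        lam = (ρ : ℂ) * Complex.exp ((φ : ℂ) * Complex.I)) →
      MemBergman p α (fun z => Complex.exp (lam * h z))) ∧
    (∀ lam : ℂ, lam ≠ 0 →
      MemBergman p α (fun z => Complex.exp (lam * h z)) →
      ∃ ρ : ℝ, 0 < ρ ∧ ∃ φ : ℝ, Real.pi / 2 ≤ φ ∧ φ ≤ 3 * Real.pi / 2 - θ ∧
        lam = (ρ : ℂ) * Complex.exp ((φ : ℂ) * Complex.I)) := by

  obtain ⟨hd, hinj, himg⟩ := hKoenigs
  have hpi := Real.pi_pos
  constructor
  · rintro lam (rfl | ⟨ρ, hρ, φ, hφ1, hφ2, rfl⟩)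
    · exact memBergman_of_bounded (C := 1) (by linarith) hα fun z _ ↦ by simp
    · have hne : {θ : ℝ | θ ∈ Ioc 0 Real.pi ∧
          ∃ q : ℂ, Ω ⊆ (fun w => q + w) '' sector 0 θ}.Nonempty := by
        by_contra hempty
        rw [outerArg, not_nonempty_iff_eq_empty.1 hempty, Real.sInf_empty] at houter
        exact hθpos.ne houter
      obtain ⟨θ', ⟨-, q, hq⟩, hθ'⟩ := exists_lt_of_csInf_lt hne
        (show sInf _ < 3 * Real.pi / 2 - φ by rw [← outerArg, houter]; linarith)
      refine memBergman_of_bounded (by linarith) hα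
        (C := Real.exp ((ρ : ℂ) * exp (φ * I) * q).re) fun z hz ↦ ?_
      obtain ⟨v, ⟨-, hv0, hv1⟩, hv⟩ := hq (himg ▸ mem_image_of_mem h hz)
      rw [norm_exp, Real.exp_le_exp, ← hv, mul_add, add_re, re_mul_exp_mul_eq ρ φ v]
      have hcos : Real.cos (φ + arg v) ≤ 0 :=
        Real.cos_nonpos_of_pi_div_two_le_of_le (by linarith) (by linarith)
      have := mul_nonpos_of_nonneg_of_nonpos (mul_nonneg hρ.le (norm_nonneg v)) hcos
      linarith
  · intro lam hlam hmem
    obtain ⟨ρ, hρ, φ, hφ1, hφ2, rfl⟩ := exists_polar_angle_ge_pi_div_two hlam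
    refine ⟨ρ, hρ, φ, hφ1, ?_, rfl⟩
    by_contra! hφ
    obtain ⟨θ', hθ', hlt⟩ := exists_lt_of_lt_csSup (singleton_nonempty (0 : ℝ)).inl
      (show max 0 (3 * Real.pi / 2 - φ) < sSup _ by
        rw [← innerArg, hinner]; exact max_lt hθpos (by linarith))
    rw [max_lt_iff] at hlt
    rcases hθ' with hθ' | ⟨⟨-, hθ'pi⟩, q, hq⟩
    · exact hlt.1.ne' hθ'
    obtain ⟨ψ, hψ1, hψ2⟩ := exists_between
      (show max 0 (3 * Real.pi / 2 - φ) < min θ' (5 * Real.pi / 2 - φ) from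
        max_lt (lt_min hlt.1 (by linarith)) (lt_min hlt.2 (by linarith)))
    rw [max_lt_iff] at hψ1
    rw [lt_min_iff] at hψ2
    have harg : arg (exp (ψ * I)) = ψ := by
      rw [arg_exp_mul_I, toIocMod_eq_self]
      constructor <;> linarith
    obtain ⟨δ, hδ, hball⟩ := exists_ball_subset_add_sector hθ'pi (u := exp (ψ * I))
      ⟨exp_ne_zero _, by rw [harg]; exact hψ1.1, by rw [harg]; exact hψ2.1⟩ q
    refine not_memBergman_exp_of_cone hd hinj (by linarith) hδ (norm_exp_ofReal_mul_I ψ)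
      (fun r hr ↦ ((hball r hr).trans hq).trans himg.superset) ?_ hmem
    rw [re_mul_exp_mul_eq, harg, norm_exp_ofReal_mul_I, mul_one]
    refine mul_pos hρ ?_
    rw [← Real.cos_sub_two_pi]
    exact Real.cos_pos_of_mem_Ioo ⟨by linarith, by linarith⟩
end
end

section
/- Let h and h̃ be injective holomorphic functions on 𝔻 whose images Ω = h(𝔻) and Ω̃ = h̃(𝔻) are convex in the positive direction and satisfy Ω ⊆ Ω̃, and let λ ∈ ℂ. Then for every p ≥ 1 and α > -1: if e^{λh̃} ∈ A_α^p then e^{λh} ∈ A_α^p; and for every p ≥ 1: if e^{λh̃} ∈ H^p then e^{λh} ∈ H^p. In other words, if Ω ⊆ Ω̃ then the point spectrums satisfy σ_{p,α} ⊇ σ̃_{p,α} and σ_p ⊇ σ̃_p. (Lemma 5.2, monotonicity of the point spectrum with respect to the Koenigs domain, without assuming h(0) = h̃(0).) -/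
open MeasureTheory Set Complex Metric
open scoped ENNReal NNReal

noncomputable section

/-- Membership in the Hardy space `H^p`:
`sup_{0 ≤ r < 1} ∫_0^{2π} |f(r e^{iθ})|^p dθ < ∞`. -/
def MemHardy (p : ℝ) (f : ℂ → ℂ) : Prop :=
  (⨆ r ∈ Ico (0 : ℝ) 1,
    ∫⁻ θ in Ioc (0 : ℝ) (2 * Real.pi),
      (‖f ((r : ℂ) * Complex.exp ((θ : ℂ) * Complex.I))‖₊ : ℝ≥0∞) ^ p) < ⊤

open Filter Topology in
theorem AnalyticAt.nhds_le_map_nhds_of_injOn {f : ℂ → ℂ} {U : Set ℂ} {z : ℂ}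
    (hf : AnalyticAt ℂ f z) (hU : U ∈ 𝓝 z) (hinj : InjOn f U) :
    𝓝 (f z) ≤ Filter.map f (𝓝 z) := by
  refine hf.eventually_constant_or_nhds_le_map_nhds.resolve_left fun hc => ?_
  have h1 : ∀ᶠ w in 𝓝[≠] z, w = z := by
    filter_upwards [nhdsWithin_le_nhds hc, nhdsWithin_le_nhds hU] with w hw hwU
    exact hinj hwU (mem_of_mem_nhds hU) hw
  obtain ⟨w, hw, hne⟩ := (h1.and self_mem_nhdsWithin).exists
  exact hne hw

open Filter Topology in
theorem differentiableAt_of_leftInverse_of_differentiableOn {f g : ℂ → ℂ} {U : Set ℂ} (hU : IsOpen U)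
    (hf : DifferentiableOn ℂ f U) (hg : ∀ z ∈ U, g (f z) = z) {z : ℂ} (hz : z ∈ U) :
    DifferentiableAt ℂ g (f z) := by
  have hinj : InjOn f U := fun a ha b hb hab => by rw [← hg a ha, hab, hg b hb]
  have han : ∀ x ∈ U, AnalyticAt ℂ f x := fun x hx => hf.analyticAt (hU.mem_nhds hx)
  have hle : ∀ x ∈ U, 𝓝 (f x) ≤ Filter.map f (𝓝 x) := fun x hx =>
    (han x hx).nhds_le_map_nhds_of_injOn (hU.mem_nhds hx) hinj
  have htend : ∀ x ∈ U, Tendsto g (𝓝 (f x)) (𝓝 x) := fun x hx => by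
    have : Tendsto (g ∘ f) (𝓝 x) (𝓝 x) :=
      tendsto_id.congr' (by filter_upwards [hU.mem_nhds hx] with y hy using (hg y hy).symm)
    exact (tendsto_map'_iff.2 this).mono_left (hle x hx)
  have hright : ∀ x ∈ U, ∀ᶠ y in 𝓝 (f x), y ∈ f '' U := fun x hx =>
    hle x hx (Filter.image_mem_map (hU.mem_nhds hx))
  have hcont : ∀ x ∈ U, ContinuousAt g (f x) := fun x hx => by
    simpa [ContinuousAt, hg x hx] using htend x hx
  have hreg : ∀ x ∈ U, deriv f x ≠ 0 → DifferentiableAt ℂ g (f x) := fun x hx hd => by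
    refine (HasDerivAt.of_local_left_inverse (f := f) (f' := deriv f x) (hcont x hx) ?_ hd
      ?_).differentiableAt
    · rw [hg x hx]; exact (han x hx).differentiableAt.hasDerivAt
    · filter_upwards [hright x hx]
      rintro _ ⟨y, hy, rfl⟩
      rw [hg y hy]
  have hne : ∀ᶠ x in 𝓝[≠] z, deriv f x ≠ 0 := by
    refine (han z hz).deriv.eventually_eq_zero_or_eventually_ne_zero.resolve_left fun h0 => ?_
    obtain ⟨ε, hε, hball⟩ := Metric.eventually_nhds_iff_ball.1
      (h0.and (hU.eventually_mem hz))
    obtain ⟨c, hc⟩ := isOpen_ball.exists_is_const_of_deriv_eq_zero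
      (convex_ball z ε).isPreconnected (hf.mono fun x hx => (hball x hx).2)
      (fun x hx => (hball x hx).1)
    have h1 : ∀ᶠ w in 𝓝[≠] z, w = z := by
      filter_upwards [nhdsWithin_le_nhds (ball_mem_nhds z hε)] with w hw
      exact hinj (hball w hw).2 hz ((hc w hw).trans (hc z (mem_ball_self hε)).symm)
    obtain ⟨w, hw, hne⟩ := (h1.and self_mem_nhdsWithin).exists
    exact hne hw
  refine (analyticAt_of_differentiable_on_punctured_nhds_of_continuousAt ?_
    (hcont z hz)).differentiableAt
  rw [eventually_nhdsWithin_iff] at hne ⊢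
  filter_upwards [hright z hz, htend z hz hne]
  rintro _ ⟨y, hy, rfl⟩ h2 h3
  rw [mem_preimage, hg y hy] at h2
  exact hreg y hy (h2 fun h => h3 (by rw [mem_singleton_iff.1 h]; rfl))

theorem exists_subordination {h k : ℂ → ℂ} {U V : Set ℂ} (hV : IsOpen V)
    (hh : DifferentiableOn ℂ h U) (hk : DifferentiableOn ℂ k V) (hinj : InjOn k V)
    (hsub : h '' U ⊆ k '' V) :
    ∃ φ : ℂ → ℂ, DifferentiableOn ℂ φ U ∧ MapsTo φ U V ∧ ∀ z ∈ U, k (φ z) = h z := by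
  have hleft : ∀ z ∈ V, Function.invFunOn k V (k z) = z := fun z hz =>
    hinj.leftInvOn_invFunOn hz
  refine ⟨fun z => Function.invFunOn k V (h z), fun z hz => ?_, fun z hz => ?_, fun z hz => ?_⟩
  · obtain ⟨y, hy, hyz⟩ := hsub (mem_image_of_mem h hz)
    have h1 := differentiableAt_of_leftInverse_of_differentiableOn hV hk hleft hy
    rw [hyz] at h1
    exact h1.comp_differentiableWithinAt z (hh z hz)
  · exact Function.invFunOn_mem (hsub (mem_image_of_mem h hz))
  · exact Function.invFunOn_eq (hsub (mem_image_of_mem h hz))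

theorem sq_norm_sub_add_eq_sq_norm_one_sub (a w : ℂ) :
    ‖w - a‖ ^ 2 + (1 - ‖a‖ ^ 2) * (1 - ‖w‖ ^ 2) = ‖1 - starRingEnd ℂ a * w‖ ^ 2 := by
  simp only [← normSq_eq_norm_sq, normSq_apply, sub_re, sub_im, mul_re, mul_im, conj_re, conj_im,
    one_re, one_im]
  ring

/-- A consequence of the Schwarz-Pick lemma: a holomorphic self-map of the disk decreases the
distance to the unit circle by at most a constant factor. -/
theorem exists_norm_le_one_sub_mul {φ : ℂ → ℂ} (hφ : DifferentiableOn ℂ φ (ball 0 1))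
    (hmaps : MapsTo φ (ball 0 1) (ball 0 1)) :
    ∃ c : ℝ, 0 < c ∧ c ≤ 1 ∧ ∀ z ∈ ball (0 : ℂ) 1, ‖φ z‖ ≤ 1 - c * (1 - ‖z‖) := by
  set a := φ 0
  have ha : ‖a‖ < 1 := by simpa using hmaps (mem_ball_self one_pos)
  have hden : ∀ w : ℂ, ‖w‖ < 1 → 1 - ‖a‖ ≤ ‖1 - starRingEnd ℂ a * w‖ := fun w hw => by
    have h1 := norm_sub_norm_le (1 : ℂ) (starRingEnd ℂ a * w)
    rw [norm_one, norm_mul, RCLike.norm_conj] at h1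
    nlinarith [norm_nonneg a]
  have hden0 : ∀ w : ℂ, ‖w‖ < 1 → 0 < ‖1 - starRingEnd ℂ a * w‖ := fun w hw =>
    (sub_pos.2 ha).trans_le (hden w hw)
  have hlt : ∀ z ∈ ball (0 : ℂ) 1, ‖φ z‖ < 1 := fun z hz => by simpa using hmaps hz
  let ψ : ℂ → ℂ := fun z => (φ z - a) / (1 - starRingEnd ℂ a * φ z)
  have hψd : DifferentiableOn ℂ ψ (ball 0 1) :=
    (hφ.sub_const a).div ((hφ.const_mul _).const_sub 1) fun z hz =>
      norm_pos_iff.1 (hden0 _ (hlt z hz))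
  have hψm : MapsTo ψ (ball 0 1) (closedBall 0 1) := fun z hz => by
    have h1 := hden0 _ (hlt z hz)
    have h2 := sq_norm_sub_add_eq_sq_norm_one_sub a (φ z)
    have h3 := hlt z hz
    rw [mem_closedBall_zero_iff, norm_div, div_le_one h1]
    refine le_of_sq_le_sq ?_ h1.le
    have : 0 ≤ (1 - ‖a‖ ^ 2) * (1 - ‖φ z‖ ^ 2) :=
      mul_nonneg (by nlinarith [norm_nonneg a]) (by nlinarith [norm_nonneg (φ z)])
    linarith
  refine ⟨(1 - ‖a‖) / 4, by linarith, by linarith [norm_nonneg a], fun z hz => ?_⟩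
  have hz1 : ‖z‖ < 1 := by simpa using hz
  have hs := Complex.norm_le_norm_of_mapsTo_ball hψd hψm (by simp [ψ, a]) hz1
  have h1 := hden0 _ (hlt z hz)
  have h2 := sq_norm_sub_add_eq_sq_norm_one_sub a (φ z)
  have h3 := hlt z hz
  rw [norm_div, div_le_iff₀ h1] at hs
  have h4 : ‖φ z - a‖ ^ 2 ≤ ‖z‖ ^ 2 * ‖1 - starRingEnd ℂ a * φ z‖ ^ 2 := by
    rw [← mul_pow]; gcongr
  have h5 : (1 - ‖a‖) ^ 2 ≤ ‖1 - starRingEnd ℂ a * φ z‖ ^ 2 :=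
    pow_le_pow_left₀ (by linarith) (hden _ h3) 2
  have hz0 := norm_nonneg z
  have ha0 := norm_nonneg a
  have hw0 := norm_nonneg (φ z)
  have h6 : (1 - ‖z‖ ^ 2) * (1 - ‖a‖) ^ 2 ≤ (1 - ‖a‖ ^ 2) * (1 - ‖φ z‖ ^ 2) := by
    have hzz : 0 ≤ 1 - ‖z‖ ^ 2 := by nlinarith
    linarith [mul_le_mul_of_nonneg_left h5 hzz]
  have h7 : (1 - ‖z‖ ^ 2) * (1 - ‖a‖) ≤ (1 + ‖a‖) * (1 - ‖φ z‖ ^ 2) := by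
    have : 0 < 1 - ‖a‖ := by linarith
    refine le_of_mul_le_mul_left ?_ this
    nlinarith
  have h8 : (1 - ‖z‖) * (1 - ‖a‖) ≤ (1 - ‖z‖ ^ 2) * (1 - ‖a‖) := by
    have : 0 ≤ 1 - ‖a‖ := by linarith
    gcongr; nlinarith
  have h9 : (1 + ‖a‖) * (1 - ‖φ z‖ ^ 2) ≤ 2 * (2 * (1 - ‖φ z‖)) := by
    refine mul_le_mul (by linarith) (by nlinarith) (by nlinarith) (by norm_num)
  nlinarith

theorem poissonKernel_nonneg {w z : ℂ} (h : ‖w‖ ≤ ‖z‖) : 0 ≤ poissonKernel 0 w z := by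
  rw [poissonKernel_def, sub_zero, sub_zero]
  have : ‖w‖ ^ 2 ≤ ‖z‖ ^ 2 := pow_le_pow_left₀ (norm_nonneg w) h 2
  exact div_nonneg (by linarith) (by positivity)

theorem poissonKernel_le {w z : ℂ} {R : ℝ} (hz : ‖z‖ = R) (hw : ‖w‖ < R) :
    poissonKernel 0 w z ≤ (R + ‖w‖) / (R - ‖w‖) := by
  have := re_herglotzRieszKernel_le (c := 0) (R := R) (w := w) (z := z) (by simpa using hz)
    (by simpa using hw)
  rw [poissonKernel_eq_re_herglotzRieszKernel, Function.comp_apply, herglotzRieszKernel_def]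
  simpa using this

/-- The Poisson integral dominates the norm of a holomorphic function. -/
theorem enorm_le_lintegral_poissonKernel {F : ℂ → ℂ} {R : ℝ} {w : ℂ}
    (hF : DiffContOnCl ℂ F (ball 0 R)) (hw : w ∈ ball (0 : ℂ) R) :
    ‖F w‖ₑ ≤ ENNReal.ofReal (2 * Real.pi)⁻¹ * ∫⁻ t in Ioc 0 (2 * Real.pi),
      ‖poissonKernel 0 w (circleMap 0 R t)‖ₑ * ‖F (circleMap 0 R t)‖ₑ := by
  have hpi := Real.two_pi_pos
  rw [← hF.circleAverage_poissonKernel_smul hw, Real.circleAverage_def, enorm_smul,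
    intervalIntegral.integral_of_le hpi.le, Real.enorm_eq_ofReal (inv_pos.2 hpi).le]
  gcongr
  refine (enorm_integral_le_lintegral_enorm _).trans_eq ?_
  simp only [Pi.smul_apply', enorm_smul]

/-- Mean value property of the Poisson kernel composed with a holomorphic function. -/
theorem lintegral_enorm_poissonKernel_comp {φ : ℂ → ℂ} {r R : ℝ} {ζ : ℂ} (hr : 0 ≤ r)
    (hφ : DifferentiableOn ℂ φ (closedBall 0 r)) (hmaps : MapsTo φ (closedBall 0 r) (ball 0 R))
    (hζ : ‖ζ‖ = R) :
    ∫⁻ θ in Ioc 0 (2 * Real.pi), ‖poissonKernel 0 (φ (circleMap 0 r θ)) ζ‖ₑ =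
      ENNReal.ofReal (2 * Real.pi * poissonKernel 0 (φ 0) ζ) := by
  have hpi := Real.two_pi_pos
  have hlt : ∀ z ∈ closedBall (0 : ℂ) r, ‖φ z‖ < ‖ζ‖ := fun z hz => by
    rw [hζ]; simpa using hmaps hz
  have hmem : ∀ θ, circleMap 0 r θ ∈ closedBall (0 : ℂ) r := circleMap_mem_closedBall 0 hr
  let H : ℂ → ℂ := fun z => herglotzRieszKernel 0 (φ z) ζ
  have hHd : DifferentiableOn ℂ H (closedBall 0 r) := by
    simp only [H, herglotzRieszKernel_def, sub_zero]
    refine (hφ.const_add ζ).div (hφ.const_sub ζ) fun z hz h0 => ?_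
    exact (hlt z hz).ne (by rw [sub_eq_zero.1 h0])
  have hHc : Continuous fun θ => H (circleMap 0 r θ) :=
    hHd.continuousOn.comp_continuous (continuous_circleMap 0 r) hmem
  have havg : Real.circleAverage H 0 r = H 0 := by
    refine DiffContOnCl.circleAverage ?_
    rw [abs_of_nonneg hr]
    exact ⟨hHd.mono ball_subset_closedBall, hHd.continuousOn.mono closure_ball_subset_closedBall⟩
  have hre : Real.circleAverage (fun z => poissonKernel 0 (φ z) ζ) 0 r
      = poissonKernel 0 (φ 0) ζ := by
    have h1 := Complex.reCLM.circleAverage_comp_comm (f := H) (c := 0) (R := r)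
      (hHc.intervalIntegrable _ _)
    rw [havg] at h1
    simp only [poissonKernel_eq_re_herglotzRieszKernel]
    exact h1
  have hPc : Continuous fun θ => poissonKernel 0 (φ (circleMap 0 r θ)) ζ := by
    simp only [poissonKernel_eq_re_herglotzRieszKernel]
    exact Complex.continuous_re.comp hHc
  have hP0 : ∀ θ, 0 ≤ poissonKernel 0 (φ (circleMap 0 r θ)) ζ := fun θ =>
    poissonKernel_nonneg (hlt _ (hmem θ)).le
  rw [← hre, Real.circleAverage_def, smul_eq_mul, mul_inv_cancel_left₀ hpi.ne',
    intervalIntegral.integral_of_le hpi.le, ofReal_integral_eq_lintegral_ofReal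
      ((hPc.intervalIntegrable 0 (2 * Real.pi)).1) (Filter.Eventually.of_forall hP0)]
  simp only [Real.enorm_eq_ofReal (hP0 _)]

/-- Littlewood subordination on circles. -/
theorem lintegral_circle_comp_le {F φ : ℂ → ℂ} {r R K : ℝ} (hr : 0 ≤ r)
    (hF : DifferentiableOn ℂ F (closedBall 0 R))
    (hφ : DifferentiableOn ℂ φ (closedBall 0 r)) (hmaps : MapsTo φ (closedBall 0 r) (ball 0 R))
    (hK : (R + ‖φ 0‖) / (R - ‖φ 0‖) ≤ K) :
    ∫⁻ θ in Ioc 0 (2 * Real.pi), ‖F (φ (circleMap 0 r θ))‖ₑ ≤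
      ENNReal.ofReal K * ∫⁻ t in Ioc 0 (2 * Real.pi), ‖F (circleMap 0 R t)‖ₑ := by
  have hpi := Real.two_pi_pos
  have h0 : ‖φ 0‖ < R := by simpa using hmaps (mem_closedBall_self hr)
  have hR : 0 ≤ R := (norm_nonneg _).trans h0.le
  have hmem : ∀ θ, circleMap 0 r θ ∈ closedBall (0 : ℂ) r := circleMap_mem_closedBall 0 hr
  have hmemR : ∀ θ, circleMap 0 R θ ∈ closedBall (0 : ℂ) R := circleMap_mem_closedBall 0 hR
  have hnorm : ∀ t, ‖circleMap 0 R t‖ = R := fun t => by simp [abs_of_nonneg hR]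
  have hFd : DiffContOnCl ℂ F (ball 0 R) :=
    ⟨hF.mono ball_subset_closedBall, hF.continuousOn.mono closure_ball_subset_closedBall⟩
  have hφc : Continuous fun θ => φ (circleMap 0 r θ) :=
    hφ.continuousOn.comp_continuous (continuous_circleMap 0 r) hmem
  have hFc : Continuous fun t => F (circleMap 0 R t) :=
    hF.continuousOn.comp_continuous (continuous_circleMap 0 R) hmemR
  have hcont : Continuous fun p : ℝ × ℝ =>
      poissonKernel 0 (φ (circleMap 0 r p.1)) (circleMap 0 R p.2) := by
    simp only [poissonKernel_def, sub_zero]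
    have h1 : Continuous fun p : ℝ × ℝ => φ (circleMap 0 r p.1) := hφc.comp continuous_fst
    have h2 : Continuous fun p : ℝ × ℝ => circleMap 0 R p.2 :=
      (continuous_circleMap 0 R).comp continuous_snd
    refine ((h2.norm.pow 2).sub (h1.norm.pow 2)).div ((h2.sub h1).norm.pow 2) fun p => ?_
    refine pow_ne_zero 2 (norm_ne_zero_iff.2 fun h => ?_)
    have h3 : ‖φ (circleMap 0 r p.1)‖ < R := by simpa using hmaps (hmem p.1)
    rw [← sub_eq_zero.1 h, hnorm] at h3
    exact lt_irrefl _ h3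
  calc ∫⁻ θ in Ioc 0 (2 * Real.pi), ‖F (φ (circleMap 0 r θ))‖ₑ
      ≤ ∫⁻ θ in Ioc 0 (2 * Real.pi), ENNReal.ofReal (2 * Real.pi)⁻¹ *
          ∫⁻ t in Ioc 0 (2 * Real.pi),
            ‖poissonKernel 0 (φ (circleMap 0 r θ)) (circleMap 0 R t)‖ₑ *
              ‖F (circleMap 0 R t)‖ₑ :=
        lintegral_mono fun θ => enorm_le_lintegral_poissonKernel hFd (hmaps (hmem θ))
    _ = ENNReal.ofReal (2 * Real.pi)⁻¹ * ∫⁻ t in Ioc 0 (2 * Real.pi),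
          ∫⁻ θ in Ioc 0 (2 * Real.pi),
            ‖poissonKernel 0 (φ (circleMap 0 r θ)) (circleMap 0 R t)‖ₑ *
              ‖F (circleMap 0 R t)‖ₑ := by
        rw [lintegral_const_mul' _ _ ENNReal.ofReal_ne_top, lintegral_lintegral_swap]
        exact (hcont.enorm.measurable.mul
          (hFc.comp continuous_snd).enorm.measurable).aemeasurable
    _ = ENNReal.ofReal (2 * Real.pi)⁻¹ * ∫⁻ t in Ioc 0 (2 * Real.pi),
          ENNReal.ofReal (2 * Real.pi * poissonKernel 0 (φ 0) (circleMap 0 R t)) *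
            ‖F (circleMap 0 R t)‖ₑ := by
        congr 1
        refine lintegral_congr fun t => ?_
        rw [lintegral_mul_const' _ _ enorm_ne_top,
          lintegral_enorm_poissonKernel_comp hr hφ hmaps (hnorm t)]
    _ ≤ ENNReal.ofReal (2 * Real.pi)⁻¹ * ∫⁻ t in Ioc 0 (2 * Real.pi),
          ENNReal.ofReal (2 * Real.pi * K) * ‖F (circleMap 0 R t)‖ₑ := by
        gcongr with t
        exact (poissonKernel_le (hnorm t) h0).trans hK
    _ = _ := by
        rw [lintegral_const_mul' _ _ ENNReal.ofReal_ne_top, ← mul_assoc,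
          ← ENNReal.ofReal_mul (inv_pos.2 hpi).le, inv_mul_cancel_left₀ hpi.ne']

/-- A holomorphic self-map `φ` of the disk comes with affine radii `1 - k (1 - r)` on which the
circle means of `F` dominate those of `F ∘ φ`, uniformly in `F` and `r`. -/
theorem exists_lintegral_circle_comp_le {φ : ℂ → ℂ} (hφ : DifferentiableOn ℂ φ (ball 0 1))
    (hmaps : MapsTo φ (ball 0 1) (ball 0 1)) :
    ∃ k K : ℝ, 0 < k ∧ k < 1 ∧ ∀ F : ℂ → ℂ, DifferentiableOn ℂ F (ball 0 1) →
      ∀ r ∈ Ico (0 : ℝ) 1, ∫⁻ θ in Ioc 0 (2 * Real.pi), ‖F (φ (circleMap 0 r θ))‖ₑ ≤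
        ENNReal.ofReal K *
          ∫⁻ t in Ioc 0 (2 * Real.pi), ‖F (circleMap 0 (1 - k * (1 - r)) t)‖ₑ := by
  obtain ⟨c, hc0, hc1, hc⟩ := exists_norm_le_one_sub_mul hφ hmaps
  refine ⟨c / 2, 4 / c, by linarith, by linarith, fun F hF r hr => ?_⟩
  obtain ⟨hr0, hr1⟩ := hr
  have hR1 : 1 - c / 2 * (1 - r) < 1 := by nlinarith
  refine lintegral_circle_comp_le hr0 (hF.mono (closedBall_subset_ball hR1))
    (hφ.mono (closedBall_subset_ball hr1)) (fun z hz => ?_) ?_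
  · have hz' : ‖z‖ ≤ r := by simpa using hz
    have := hc z (closedBall_subset_ball hr1 hz)
    rw [mem_ball_zero_iff]
    nlinarith
  · have h0 := hc 0 (mem_ball_self one_pos)
    rw [norm_zero] at h0
    have hn := norm_nonneg (φ 0)
    have hgap : c / 2 ≤ 1 - c / 2 * (1 - r) - ‖φ 0‖ := by nlinarith
    calc _ ≤ 2 / (c / 2) := by gcongr; nlinarith
      _ = 4 / c := by field_simp; norm_num

theorem lintegral_circleMap_Ioo_neg_pi_pi (g : ℂ → ℝ≥0∞) (r : ℝ) :
    ∫⁻ θ in Ioo (-Real.pi) Real.pi, g (circleMap 0 r θ) =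
      ∫⁻ θ in Ioc 0 (2 * Real.pi), g (circleMap 0 r θ) := by
  rw [setLIntegral_congr Ioo_ae_eq_Ioc]
  have h1 := isAddFundamentalDomain_Ioc Real.two_pi_pos (-Real.pi)
  have h2 := isAddFundamentalDomain_Ioc Real.two_pi_pos 0
  rw [show -Real.pi + 2 * Real.pi = Real.pi by ring] at h1
  rw [zero_add] at h2
  refine h1.setLIntegral_eq h2 _ ?_
  rintro ⟨_, n, rfl⟩ x
  congr 1
  have := (periodic_circleMap 0 r).zsmul n x
  rw [← this, add_comm]
  rfl

theorem lintegral_eq_lintegral_circleMap {g : ℂ → ℝ≥0∞} (hg : Measurable g) :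
    ∫⁻ z, g z = ∫⁻ r in Ioi (0 : ℝ), ENNReal.ofReal r *
      ∫⁻ θ in Ioc 0 (2 * Real.pi), g (circleMap 0 r θ) := by
  have hcm : ∀ p : ℝ × ℝ, Complex.polarCoord.symm p = circleMap 0 p.1 p.2 := fun p => by
    rw [Complex.polarCoord_symm_apply, circleMap, zero_add, Complex.exp_mul_I, ofReal_cos,
      ofReal_sin]
  have hmeas : Measurable fun p : ℝ × ℝ => ENNReal.ofReal p.1 * g (circleMap 0 p.1 p.2) := by
    refine (ENNReal.measurable_ofReal.comp measurable_fst).mul (hg.comp ?_)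
    unfold circleMap
    fun_prop
  rw [← Complex.lintegral_comp_polarCoord_symm, polarCoord_target,
    Measure.volume_eq_prod, ← Measure.prod_restrict]
  simp only [hcm, smul_eq_mul]
  rw [lintegral_prod _ hmeas.aemeasurable]
  refine lintegral_congr fun r => ?_
  rw [lintegral_const_mul' _ _ ENNReal.ofReal_ne_top, lintegral_circleMap_Ioo_neg_pi_pi]

theorem lintegral_ball_eq_lintegral_circleMap {u : ℂ → ℂ} (hu : ContinuousOn u (ball 0 1))
    {w : ℝ → ℝ≥0∞} (hw : Measurable w) :
    ∫⁻ z in ball (0 : ℂ) 1, ‖u z‖ₑ * w ‖z‖ =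
      ∫⁻ r in Ioo (0 : ℝ) 1, ENNReal.ofReal r * w r *
        ∫⁻ θ in Ioc 0 (2 * Real.pi), ‖u (circleMap 0 r θ)‖ₑ := by
  have hmeas : Measurable ((ball (0 : ℂ) 1).indicator fun z => ‖u z‖ₑ * w ‖z‖) := by
    have h1 : Measurable ((ball (0 : ℂ) 1).indicator fun z => ‖u z‖ₑ) := by
      classical
      have := (hu.enorm.measurable_piecewise (g := fun _ => 0) continuousOn_const
        measurableSet_ball)
      simpa [Set.piecewise_eq_indicator] using! this
    have h2 := h1.mul (hw.comp measurable_norm)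
    convert h2 using 1
    ext z
    by_cases hz : z ∈ ball (0 : ℂ) 1 <;> simp [hz]
  rw [← lintegral_indicator measurableSet_ball, lintegral_eq_lintegral_circleMap hmeas,
    ← Ioi_inter_Iio, inter_comm, ← Measure.restrict_restrict measurableSet_Iio,
    ← lintegral_indicator measurableSet_Iio]
  refine setLIntegral_congr_fun measurableSet_Ioi fun r hr => ?_
  have hr0 : (0 : ℝ) < r := hr
  by_cases hr1 : r < 1
  · have hm : ∀ θ, circleMap 0 r θ ∈ ball (0 : ℂ) 1 := fun θ => by simp [abs_of_pos hr0, hr1]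
    have hn : ∀ θ, ‖circleMap 0 r θ‖ = r := fun θ => by simp [abs_of_pos hr0]
    rw [indicator_of_mem (show r ∈ Iio 1 from hr1), mul_assoc, mul_comm (w r)]
    simp only [indicator_of_mem (hm _), hn]
    rw [lintegral_mul_const]
    have hc : Continuous fun θ => u (circleMap 0 r θ) :=
      hu.comp_continuous (continuous_circleMap 0 r) hm
    exact hc.enorm.measurable
  · have hm : ∀ θ, circleMap 0 r θ ∉ ball (0 : ℂ) 1 := fun θ => by
      simpa [abs_of_pos hr0] using hr1
    rw [indicator_of_notMem (show r ∉ Iio 1 from hr1)]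
    simp only [indicator_of_notMem (hm _), lintegral_zero, mul_zero]

/-- Affine change of radius in the unit interval. -/
theorem lintegral_Ioo_comp_affine_le {k : ℝ} (hk0 : 0 < k) (hk1 : k < 1) (G : ℝ → ℝ≥0∞) :
    ∫⁻ r in Ioo (0 : ℝ) 1, G (1 - k * (1 - r)) ≤
      ENNReal.ofReal k⁻¹ * ∫⁻ r in Ioo (0 : ℝ) 1, G r := by
  let e : ℝ ≃ᵐ ℝ := (Homeomorph.mulLeft₀ k hk0.ne').toMeasurableEquiv
  let e' : ℝ ≃ᵐ ℝ := (Homeomorph.addLeft (1 - k)).toMeasurableEquiv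
  have he : ∀ H : ℝ → ℝ≥0∞, ∫⁻ r, H (k * r) = ENNReal.ofReal k⁻¹ * ∫⁻ r, H r := fun H => by
    have h1 := lintegral_map_equiv (μ := volume) H e
    have h2 : Measure.map e volume = ENNReal.ofReal |k⁻¹| • volume :=
      Real.map_volume_mul_left hk0.ne'
    rw [h2, lintegral_smul_measure, abs_of_pos (inv_pos.2 hk0)] at h1
    exact h1.symm
  have hadd : ∀ H : ℝ → ℝ≥0∞, ∫⁻ r, H (1 - k + r) = ∫⁻ r, H r := fun H =>
    lintegral_add_left_eq_self H (1 - k)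
  calc ∫⁻ r in Ioo (0 : ℝ) 1, G (1 - k * (1 - r))
      ≤ ∫⁻ r, (Ioo (0 : ℝ) 1).indicator G (1 - k + k * r) := by
        rw [← lintegral_indicator measurableSet_Ioo]
        refine lintegral_mono fun r => ?_
        by_cases hr : r ∈ Ioo (0 : ℝ) 1
        swap
        · simp only [indicator_of_notMem hr, zero_le]
        have hmem : 1 - k + k * r ∈ Ioo (0 : ℝ) 1 :=
          ⟨by nlinarith [hr.1], by nlinarith [hr.2]⟩
        rw [indicator_of_mem hr, indicator_of_mem hmem, show 1 - k * (1 - r) = 1 - k + k * r by ring]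
    _ = ENNReal.ofReal k⁻¹ * ∫⁻ r in Ioo (0 : ℝ) 1, G r := by
        rw [he fun x => (Ioo (0 : ℝ) 1).indicator G (1 - k + x), hadd,
          lintegral_indicator measurableSet_Ioo]

theorem exists_rpow_weight_le {k : ℝ} (hk0 : 0 < k) (hk1 : k < 1) (α : ℝ) :
    ∃ C : ℝ, 0 ≤ C ∧ ∀ r ∈ Ioo (0 : ℝ) 1, r * (1 - r ^ 2) ^ α ≤
      C * ((1 - k * (1 - r)) * (1 - (1 - k * (1 - r)) ^ 2) ^ α) := by
  refine ⟨k ^ (-α) + (2 * k) ^ (-α), by positivity, fun r hr => ?_⟩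
  obtain ⟨hr0, hr1⟩ := hr
  set R := 1 - k * (1 - r) with hR
  have hrR : r ≤ R := by nlinarith
  have ha : 0 < 1 - r ^ 2 := by nlinarith
  have hkR : k * (1 - r ^ 2) ≤ 1 - R ^ 2 := by
    have : 1 - R ^ 2 = k * (1 - r) * (1 + R) := by rw [hR]; ring
    rw [this]
    nlinarith [mul_pos hk0 (sub_pos.2 hr1)]
  have hRk : 1 - R ^ 2 ≤ 2 * k * (1 - r ^ 2) := by
    have : 1 - R ^ 2 = k * (1 - r) * (1 + R) := by rw [hR]; ring
    rw [this]
    have h1 : R < 1 := by nlinarith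
    nlinarith [mul_pos hk0 (sub_pos.2 hr1)]
  have hb : 0 < 1 - R ^ 2 := (mul_pos hk0 ha).trans_le hkR
  have hw : (1 - r ^ 2) ^ α ≤ (k ^ (-α) + (2 * k) ^ (-α)) * (1 - R ^ 2) ^ α := by
    have hpos := Real.rpow_nonneg hb.le α
    have h1 : 0 ≤ k ^ (-α) := by positivity
    have h2 : 0 ≤ (2 * k) ^ (-α) := by positivity
    rcases le_total 0 α with hα | hα
    · have := Real.rpow_le_rpow (by positivity) hkR hα
      rw [Real.mul_rpow hk0.le ha.le] at this
      calc (1 - r ^ 2) ^ α = k ^ (-α) * (k ^ α * (1 - r ^ 2) ^ α) := by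
            rw [← mul_assoc, ← Real.rpow_add hk0]; simp
        _ ≤ k ^ (-α) * (1 - R ^ 2) ^ α := by gcongr
        _ ≤ _ := by gcongr; linarith
    · have h2k : 0 < 2 * k := by linarith
      have := Real.rpow_le_rpow_of_nonpos hb hRk hα
      rw [Real.mul_rpow h2k.le ha.le] at this
      calc (1 - r ^ 2) ^ α = (2 * k) ^ (-α) * ((2 * k) ^ α * (1 - r ^ 2) ^ α) := by
            rw [← mul_assoc, ← Real.rpow_add h2k]; simp
        _ ≤ (2 * k) ^ (-α) * (1 - R ^ 2) ^ α := by gcongr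
        _ ≤ _ := by gcongr; linarith
  calc r * (1 - r ^ 2) ^ α ≤ R * ((k ^ (-α) + (2 * k) ^ (-α)) * (1 - R ^ 2) ^ α) := by
        gcongr
        exact hr0.le.trans hrR
    _ = _ := by ring

/-- Littlewood subordination in weighted Bergman spaces. -/
theorem lintegral_ball_comp_lt_top {F φ : ℂ → ℂ} (hF : DifferentiableOn ℂ F (ball 0 1))
    (hφ : DifferentiableOn ℂ φ (ball 0 1)) (hmaps : MapsTo φ (ball 0 1) (ball 0 1)) {α : ℝ}
    (hfin : ∫⁻ z in ball (0 : ℂ) 1, ‖F z‖ₑ * ENNReal.ofReal ((1 - ‖z‖ ^ 2) ^ α) < ⊤) :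
    ∫⁻ z in ball (0 : ℂ) 1, ‖F (φ z)‖ₑ * ENNReal.ofReal ((1 - ‖z‖ ^ 2) ^ α) < ⊤ := by
  obtain ⟨k, K, hk0, hk1, hcirc⟩ := exists_lintegral_circle_comp_le hφ hmaps
  obtain ⟨C, hC0, hC⟩ := exists_rpow_weight_le hk0 hk1 α
  have hw : Measurable fun r : ℝ => ENNReal.ofReal ((1 - r ^ 2) ^ α) := by fun_prop
  rw [lintegral_ball_eq_lintegral_circleMap hF.continuousOn hw] at hfin
  rw [lintegral_ball_eq_lintegral_circleMap (u := fun z => F (φ z))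
    (hF.continuousOn.comp hφ.continuousOn hmaps) hw]
  set G : ℝ → ℝ≥0∞ := fun r => ENNReal.ofReal r * ENNReal.ofReal ((1 - r ^ 2) ^ α) *
    ∫⁻ θ in Ioc 0 (2 * Real.pi), ‖F (circleMap 0 r θ)‖ₑ
  refine lt_of_le_of_lt (b := ENNReal.ofReal C * ENNReal.ofReal K *
    (ENNReal.ofReal k⁻¹ * ∫⁻ r in Ioo (0 : ℝ) 1, G r)) ?_ ?_
  · refine le_trans ?_ (mul_le_mul_right (lintegral_Ioo_comp_affine_le hk0 hk1 G) _)
    rw [← lintegral_const_mul' _ _ (by finiteness)]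
    refine setLIntegral_mono' measurableSet_Ioo fun r hr => ?_
    have hR0 : 0 ≤ 1 - k * (1 - r) := by nlinarith [hr.1, hr.2]
    calc _ ≤ ENNReal.ofReal (C * ((1 - k * (1 - r)) * (1 - (1 - k * (1 - r)) ^ 2) ^ α)) *
          (ENNReal.ofReal K *
            ∫⁻ t in Ioc 0 (2 * Real.pi), ‖F (circleMap 0 (1 - k * (1 - r)) t)‖ₑ) := by
          rw [← ENNReal.ofReal_mul hr.1.le]
          exact mul_le_mul' (ENNReal.ofReal_le_ofReal (hC r hr)) (hcirc F hF r ⟨hr.1.le, hr.2⟩)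
      _ = _ := by
          rw [ENNReal.ofReal_mul hC0, ENNReal.ofReal_mul hR0]
          ring
  · exact ENNReal.mul_lt_top (by finiteness) (ENNReal.mul_lt_top (by finiteness) hfin)

theorem nnnorm_exp_rpow (a : ℂ) (p : ℝ) :
    ((‖Complex.exp a‖₊ : ℝ≥0∞)) ^ p = ‖Complex.exp (p * a)‖ₑ := by
  rw [← enorm_eq_nnnorm, ← ofReal_norm, ← ofReal_norm, Complex.norm_exp,
    Complex.norm_exp, ENNReal.ofReal_rpow_of_pos (Real.exp_pos _), ← Real.exp_mul]
  simp [mul_comm]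

/-- **Lemma 5.2.** Monotonicity of the point spectrum with respect to the Koenigs domain, for
Bergman spaces `A_α^p` (`p ≥ 1`, `α > -1`) and Hardy spaces `H^p` (`p ≥ 1`): if the Koenigs
domains satisfy `Ω ⊆ Ω̃`, then membership of `e^{λh̃}` implies membership of `e^{λh}`. -/
theorem spectrum_monotone_koenigs_domain
    (h h' : ℂ → ℂ)
    (hdiff : DifferentiableOn ℂ h (ball 0 1)) (hinj : InjOn h (ball 0 1))
    (hdiff' : DifferentiableOn ℂ h' (ball 0 1)) (hinj' : InjOn h' (ball 0 1))
    (hconv : ConvexPosDir (h '' ball 0 1)) (hconv' : ConvexPosDir (h' '' ball 0 1))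
    (hsub : h '' ball 0 1 ⊆ h' '' ball 0 1)
    (lam : ℂ) :
    (∀ p α : ℝ, 1 ≤ p → -1 < α →
      MemBergman p α (fun z => Complex.exp (lam * h' z)) →
      MemBergman p α (fun z => Complex.exp (lam * h z))) ∧
    (∀ p : ℝ, 1 ≤ p →
      MemHardy p (fun z => Complex.exp (lam * h' z)) →
      MemHardy p (fun z => Complex.exp (lam * h z))) := by
  obtain ⟨φ, hφ, hmaps, hcomp⟩ := exists_subordination isOpen_ball hdiff hdiff' hinj' hsub
  have hF : ∀ p : ℝ, DifferentiableOn ℂ (fun z => Complex.exp (p * (lam * h' z))) (ball 0 1) :=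
    fun p => ((hdiff'.const_mul lam).const_mul (p : ℂ)).cexp
  refine ⟨fun p α _ _ hB => ?_, fun p _ hH => ?_⟩
  · simp only [MemBergman, nnnorm_exp_rpow] at hB ⊢
    refine (setLIntegral_congr_fun measurableSet_ball fun z hz => ?_).trans_lt
      (lintegral_ball_comp_lt_top (hF p) hφ hmaps hB)
    simp only [hcomp z hz]
  · have hcm : ∀ r θ : ℝ, (r : ℂ) * Complex.exp (θ * Complex.I) = circleMap 0 r θ := fun r θ => by
      rw [circleMap, zero_add]
    simp only [MemHardy, nnnorm_exp_rpow, hcm] at hH ⊢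
    obtain ⟨k, K, hk0, hk1, hcirc⟩ := exists_lintegral_circle_comp_le hφ hmaps
    refine lt_of_le_of_lt (iSup₂_le fun r hr => ?_)
      (ENNReal.mul_lt_top (ENNReal.ofReal_lt_top (r := K)) hH)
    have hR : 1 - k * (1 - r) ∈ Ico (0 : ℝ) 1 :=
      ⟨by nlinarith [hr.1, hr.2], by nlinarith [hr.1, hr.2]⟩
    calc _ = ∫⁻ θ in Ioc 0 (2 * Real.pi),
          ‖Complex.exp (p * (lam * h' (φ (circleMap 0 r θ))))‖ₑ := by
          refine lintegral_congr fun θ => ?_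
          rw [hcomp _ (by simpa [abs_of_nonneg hr.1] using hr.2)]
      _ ≤ _ := hcirc _ (hF p) r hr
      _ ≤ _ := by
          gcongr
          exact le_iSup₂ (f := fun r (_ : r ∈ Ico (0 : ℝ) 1) => ∫⁻ θ in Ioc 0 (2 * Real.pi),
            ‖Complex.exp (p * (lam * h' (circleMap 0 r θ)))‖ₑ) _ hR
end
end
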